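/- arXiv:cs/0509023 — 3 statements merged into one kernel-verified Lean document; each statement's English description precedes it below -/
import Mathlib

section
/- If a finite simple graph G is Meyniel (every odd cycle of G of length at least five has at least two chords), then the chromatic number of G equals its clique number; that is, G has a clique Q and a proper vertex coloring that uses exactly |Q| colors. -/
open SimpleGraph

/-- The set of chords of a closed walk `c` in `G`: edges of `G` joining two
vertices of `c` that are not edges of `c` (i.e. not consecutive on `c`). -/
def SimpleGraph.cycleChords {V : Type*} (G : SimpleGraph V) {u : V} (c : G.Walk u u) :
    Set (Sym2 V) :=
  {e | e ∈ G.edgeSet ∧ (∀ x ∈ e, x ∈ c.support) ∧ e ∉ c.edges}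

/-- `G` is Meyniel if every odd cycle of length at least five has at least two chords. -/
def SimpleGraph.IsMeyniel {V : Type*} (G : SimpleGraph V) : Prop :=
  ∀ ⦃u : V⦄ (c : G.Walk u u), c.IsCycle → Odd c.length → 5 ≤ c.length →
    2 ≤ (G.cycleChords c).ncard

namespace MeynielProof

open Relation

variable {V : Type*}

/-- The walk along a sequence of vertices. -/
def seqWalk (G : SimpleGraph V) (p : ℕ → V) : (m : ℕ) → (∀ i < m, G.Adj (p i) (p (i+1))) →
    G.Walk (p 0) (p m)
  | 0, _ => Walk.nil
  | m+1, h => (seqWalk G p m (fun i hi => h i (by omega))).concat (h m (by omega))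

lemma seqWalk_length (G : SimpleGraph V) (p : ℕ → V) (m : ℕ)
    (h : ∀ i < m, G.Adj (p i) (p (i+1))) : (seqWalk G p m h).length = m := by
  induction m with
  | zero => rfl
  | succ m ih => simp [seqWalk, ih]

lemma seqWalk_support (G : SimpleGraph V) (p : ℕ → V) (m : ℕ)
    (h : ∀ i < m, G.Adj (p i) (p (i+1))) :
    (seqWalk G p m h).support = (List.range (m+1)).map p := by
  induction m with
  | zero => rfl
  | succ m ih =>
    rw [List.range_succ, List.map_append, ← ih (fun i hi => h i (by omega))]
    simp [seqWalk, Walk.support_concat]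

lemma seqWalk_edges (G : SimpleGraph V) (p : ℕ → V) (m : ℕ)
    (h : ∀ i < m, G.Adj (p i) (p (i+1))) (i : ℕ) (hi : i < m) :
    s(p i, p (i+1)) ∈ (seqWalk G p m h).edges := by
  induction m with
  | zero => omega
  | succ m ih =>
    simp only [seqWalk, Walk.edges_concat, List.concat_eq_append, List.mem_append,
      List.mem_singleton]
    by_cases him : i = m
    · subst him; right; rfl
    · left; exact ih (fun i hi => h i (by omega)) (by omega)

lemma cyc {G : SimpleGraph V} (hG : G.IsMeyniel) (p : ℕ → V) (v : V) (m : ℕ)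
    (hm : 3 ≤ m) (hodd : Odd m)
    (hadj : ∀ i < m, G.Adj (p i) (p (i+1)))
    (hinj : ∀ i j, i ≤ m → j ≤ m → p i = p j → i = j)
    (hch : ∀ i j, i + 2 ≤ j → j ≤ m → ¬ G.Adj (p i) (p j))
    (hv : ∀ i ≤ m, p i ≠ v) (h0 : G.Adj v (p 0)) (h1 : G.Adj v (p m))
    (k : ℕ) (hk : ∀ i, 0 < i → i < m → G.Adj v (p i) → i = k) : False := by
  set w := seqWalk G p m hadj with hw
  have hsup : w.support = (List.range (m+1)).map p := seqWalk_support G p m hadj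
  have hmem : ∀ x, x ∈ w.support ↔ ∃ i ≤ m, p i = x := by
    intro x; rw [hsup]; simp [Nat.lt_succ_iff]
  have hpath : w.IsPath := by
    rw [Walk.isPath_def, hsup]
    apply List.Nodup.map_on _ List.nodup_range
    intro x hx y hy hxy
    simp only [List.mem_range] at hx hy
    exact hinj x y (by omega) (by omega) hxy
  have hvw : v ∉ w.support := by
    rw [hmem]; rintro ⟨i, hi, h⟩; exact hv i hi h
  have hc : (Walk.cons h1.symm (Walk.cons h0 w)).IsCycle := by
    rw [Walk.cons_isCycle_iff, Walk.cons_isPath_iff]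
    refine ⟨⟨hpath, hvw⟩, ?_⟩
    rw [Walk.edges_cons, List.mem_cons]
    rintro (h | h)
    · have : p m = p 0 := by
        rw [Sym2.eq_iff] at h
        rcases h with ⟨h, _⟩ | ⟨h, _⟩
        · exact absurd h (hv m le_rfl)
        · exact h
      have := hinj m 0 le_rfl (by omega) this
      omega
    · exact hvw (Walk.snd_mem_support_of_mem_edges w h)
  have hlen : (Walk.cons h1.symm (Walk.cons h0 w)).length = m + 2 := by
    simp [hw, seqWalk_length]
  have h2 := hG _ hc (by rw [hlen]; grind) (by rw [hlen]; omega)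
  have hv1 : ∀ i ≤ m, G.Adj v (p i) →
      s(v, p i) ∉ (Walk.cons h1.symm (Walk.cons h0 w)).edges → i = k := by
    intro i hi ha hn
    refine hk i ?_ ?_ ha
    · rcases Nat.eq_zero_or_pos i with h | h
      · subst h; exact absurd (by simp) hn
      · exact h
    · rcases hi.eq_or_lt with h | h
      · subst h; exact absurd (by simp [Sym2.eq_swap]) hn
      · exact h
  have hsub : G.cycleChords (Walk.cons h1.symm (Walk.cons h0 w)) ⊆ {s(v, p k)} := by
    intro e
    induction e using Sym2.ind with
    | _ x y =>
    rintro ⟨he, hs, hn⟩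
    have hx := hs x (by simp)
    have hy := hs y (by simp)
    rw [mem_edgeSet] at he
    have key : ∀ z, z ∈ (Walk.cons h1.symm (Walk.cons h0 w)).support →
        z = v ∨ ∃ i ≤ m, p i = z := by
      intro z hz
      simp only [Walk.support_cons, List.mem_cons] at hz
      rcases hz with h | h | h
      · right; exact ⟨m, le_rfl, h.symm⟩
      · left; exact h
      · right; exact (hmem z).1 h
    rcases key x hx with rfl | ⟨i, hi, rfl⟩
    · rcases key y hy with rfl | ⟨j, hj, rfl⟩
      · exact absurd he (G.loopless.irrefl _)
      · rw [hv1 j hj he hn]; rfl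
    · rcases key y hy with rfl | ⟨j, hj, rfl⟩
      · rw [Sym2.eq_swap] at hn ⊢
        rw [hv1 i hi he.symm hn]; rfl
      · exfalso
        have hne : ∀ i < m, s(p i, p (i+1)) ∈ (Walk.cons h1.symm (Walk.cons h0 w)).edges := by
          intro i hi
          rw [Walk.edges_cons, Walk.edges_cons]
          exact List.mem_cons_of_mem _ (List.mem_cons_of_mem _ (seqWalk_edges G p m hadj i hi))
        rcases lt_trichotomy i j with h | h | h
        · by_cases h' : j = i + 1
          · subst h'; exact hn (hne i (by omega))
          · exact hch i j (by omega) hj he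
        · subst h; exact G.loopless.irrefl _ he
        · by_cases h' : i = j + 1
          · subst h'; rw [Sym2.eq_swap] at hn; exact hn (hne j (by omega))
          · exact hch j i (by omega) hi he.symm
  have := Set.ncard_le_ncard hsub (Set.finite_singleton _)
  rw [Set.ncard_singleton] at this
  omega

lemma lemA {G : SimpleGraph V} (hG : G.IsMeyniel) (v : V) (n : ℕ) : ∀ (p : ℕ → V)
    (_ : Odd n)
    (_ : ∀ i < n, G.Adj (p i) (p (i+1)))
    (_ : ∀ i j, i ≤ n → j ≤ n → p i = p j → i = j)
    (_ : ∀ i j, i + 2 ≤ j → j ≤ n → ¬ G.Adj (p i) (p j))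
    (_ : ∀ i ≤ n, p i ≠ v) (_ : G.Adj v (p 0)) (_ : G.Adj v (p n)),
    ∀ i ≤ n, G.Adj v (p i) := by
  classical
  induction n using Nat.strong_induction_on with
  | _ n ih =>
  intro p hodd hadj hinj hch hv h0 h1
  have sub : ∀ j, 0 < j → j ≤ n → Odd (n - j) → G.Adj v (p j) →
      ∀ i, j ≤ i → i ≤ n → G.Adj v (p i) := by
    intro j hj0 hjn ho hj i hi hin
    have := ih (n - j) (by omega) (fun i => p (j + i)) ho
      (fun i hi => hadj (j+i) (by omega))
      (fun i i' hi hi' h => by have := hinj _ _ (by omega) (by omega) h; omega)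
      (fun i i' hi hi' h => hch _ _ (by omega) (by omega) h)
      (fun i hi => hv _ (by omega)) (by simpa using hj)
      (by simpa [Nat.add_sub_cancel' hjn] using h1) (i - j) (by omega)
    simpa [Nat.add_sub_cancel' hi] using this
  have hn0 : 0 < n := hodd.pos
  have cyc' : ∀ s m k, s + m ≤ n → 3 ≤ m → Odd m → G.Adj v (p s) → G.Adj v (p (s+m)) →
      (∀ i, s < i → i < s + m → G.Adj v (p i) → i = k) → False := by
    intro s m k hsm hm ho hs he hk
    refine cyc hG (fun i => p (s + i)) v m hm ho
      (fun i hi => hadj (s+i) (by omega))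
      (fun i i' hi hi' h => by have := hinj _ _ (by omega) (by omega) h; omega)
      (fun i i' hi hi' h => hch _ _ (by omega) (by omega) h)
      (fun i hi => hv _ (by omega)) hs he (k - s) ?_
    intro i hi hi' ha
    have := hk (s+i) (by omega) (by omega) ha
    omega
  have next : ∀ s < n, ∃ i, s < i ∧ i ≤ n ∧ G.Adj v (p i) ∧
      ∀ l, s < l → l < i → ¬ G.Adj v (p l) := by
    intro s hs
    have hex : ∃ i, s < i ∧ i ≤ n ∧ G.Adj v (p i) := ⟨n, hs, le_rfl, h1⟩
    refine ⟨Nat.find hex, (Nat.find_spec hex).1, (Nat.find_spec hex).2.1,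
      (Nat.find_spec hex).2.2, ?_⟩
    intro l hl hl' ha
    have := (Nat.find_spec hex).2.1
    exact Nat.find_min hex hl' ⟨hl, by omega, ha⟩
  obtain ⟨i, hi0, hin, hi, himin⟩ := next 0 hn0
  by_cases hi1 : i = 1
  · subst hi1
    by_cases hn1 : n = 1
    · intro l hl
      subst hn1
      interval_cases l <;> assumption
    obtain ⟨j, hj0, hjn, hj, hjmin⟩ := next 1 (by omega)
    have hje : ¬ Odd j := by
      intro ho
      refine cyc' 0 j 1 (by omega) (by grind) ho h0 (by simpa using hj) ?_
      intro l hl hl' ha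
      by_contra hne
      exact hjmin l (by omega) (by omega) ha
    have hj2 : j = 2 := by
      by_contra hne
      refine cyc' 1 (j-1) 0 (by omega) (by grind) (by grind) hi
        (by rwa [Nat.add_sub_cancel' (by omega)]) ?_
      intro l hl hl' ha
      exact absurd ha (hjmin l (by omega) (by omega))
    subst hj2
    intro l hl
    rcases Nat.lt_or_ge l 2 with h | h
    · interval_cases l <;> assumption
    · exact sub 2 (by omega) hjn (by grind) hj l h hl
  · have hie : ¬ Odd i := by
      intro ho
      refine cyc' 0 i 0 (by omega) (by grind) ho h0 (by simpa using hi) ?_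
      intro l hl hl' ha
      exact absurd ha (himin l (by omega) (by omega))
    have hlt : i < n := by
      rcases hin.eq_or_lt with h | h
      · subst h; exact absurd hodd hie
      · exact h
    exfalso
    have hs := sub i hi0 hin (by grind) hi (i+1) (by omega) (by omega)
    refine cyc' 0 (i+1) i (by omega) (by omega) (by grind) h0 (by simpa using hs) ?_
    intro l hl hl' ha
    by_contra hne
    exact himin l (by omega) (by omega) ha

/-- Bichromatic subgraph. -/
def bi (G : SimpleGraph V) (W : Finset V) (f : V → ℕ) (a b : ℕ) : SimpleGraph V where
  Adj x y := G.Adj x y ∧ x ∈ W ∧ y ∈ W ∧ (f x = a ∨ f x = b) ∧ (f y = a ∨ f y = b)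
  symm := ⟨fun _ _ h => ⟨h.1.symm, h.2.2.1, h.2.1, h.2.2.2.2, h.2.2.2.1⟩⟩
  loopless := ⟨fun _ h => G.loopless.irrefl _ h.1⟩

structure Good (G : SimpleGraph V) (W : Finset V) (f : V → ℕ) (a b : ℕ) (U : Set V) : Prop where
  sub : ∀ x ∈ U, x ∈ W ∧ (f x = a ∨ f x = b)
  closed : ∀ x ∈ U, ∀ y, (bi G W f a b).Adj x y → y ∈ U
  sing : ∀ x ∈ U, ∀ y ∈ W, f y = f x → (∀ z, ¬ (bi G W f a b).Adj x z) →
    (∀ z, ¬ (bi G W f a b).Adj y z) → y ∈ U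

def Move (G : SimpleGraph V) (W : Finset V) (K : Finset ℕ) (f g : V → ℕ) : Prop :=
  ∃ a ∈ K, ∃ b ∈ K, a ≠ b ∧ ∃ U : Set V, Good G W f a b U ∧
    (∀ x, x ∉ U → g x = f x) ∧ (∀ x ∈ U, f x = a → g x = b) ∧ (∀ x ∈ U, f x = b → g x = a)

def Proper (G : SimpleGraph V) (W : Finset V) (f : V → ℕ) : Prop :=
  ∀ x ∈ W, ∀ y ∈ W, G.Adj x y → f x ≠ f y

lemma Move.proper {G : SimpleGraph V} {W : Finset V} {K : Finset ℕ} {f g : V → ℕ}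
    (h : Move G W K f g) (hf : Proper G W f) : Proper G W g := by
  obtain ⟨a, ha, b, hb, hab, U, hU, h1, h2, h3⟩ := h
  have hs := hU.sub
  have hc : ∀ x ∈ U, ∀ y ∈ W, G.Adj x y → (f y = a ∨ f y = b) → y ∈ U := by
    intro x hx y hy hxy hf
    exact hU.closed x hx y ⟨hxy, (hs x hx).1, hy, (hs x hx).2, hf⟩
  intro x hx y hy hxy
  have := hf x hx y hy hxy
  have := hc x
  have := hc y
  have := hxy.symm
  have := hs x
  have := hs y
  by_cases x ∈ U <;> by_cases y ∈ U <;> grind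

lemma Move.mem {G : SimpleGraph V} {W : Finset V} {K K' : Finset ℕ} {f g : V → ℕ}
    (h : Move G W K f g) (hK : K ⊆ K') (x : V) : g x ∈ K' ↔ f x ∈ K' := by
  obtain ⟨a, ha, b, hb, hab, U, hU, h1, h2, h3⟩ := h
  have := hU.sub x
  have := hK ha
  have := hK hb
  by_cases x ∈ U <;> grind

lemma Move.eq_of_not_mem {G : SimpleGraph V} {W : Finset V} {K : Finset ℕ} {f g : V → ℕ}
    (h : Move G W K f g) {c : ℕ} (hc : c ∉ K) (x : V) : g x = c ↔ f x = c := by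
  obtain ⟨a, ha, b, hb, hab, U, hU, h1, h2, h3⟩ := h
  have := hU.sub x
  by_cases x ∈ U <;> grind

lemma Move.mono {G : SimpleGraph V} {W : Finset V} {K K' : Finset ℕ} {f g : V → ℕ}
    (h : Move G W K f g) (hK : K ⊆ K') : Move G W K' f g := by
  obtain ⟨a, ha, b, hb, r⟩ := h
  exact ⟨a, hK ha, b, hK hb, r⟩

lemma lemB {G : SimpleGraph V} (hG : G.IsMeyniel) {W N : Finset V} {f : V → ℕ} {a b : ℕ}
    {v : V} (hf : Proper G W f) (hN : ∀ x, x ∈ N ↔ x ∈ W ∧ G.Adj v x)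
    (hv : ∀ x ∈ W, (f x = a ∨ f x = b) → x ≠ v) {U : Set V}
    (hU : ∀ x ∈ U, ∀ y, (bi G N f a b).Adj x y → y ∈ U) {x y : V}
    (hx : x ∈ N) (hxU : x ∈ U) (hy : y ∈ N) (hr : (bi G W f a b).Reachable x y)
    (hne : f x ≠ f y) : y ∈ U := by
  obtain ⟨w, hw⟩ := hr.exists_walk_length_eq_dist
  have hp : w.IsPath := w.isPath_of_length_eq_dist hw
  set n := w.length with hn
  have hadj : ∀ i < n, (bi G W f a b).Adj (w.getVert i) (w.getVert (i+1)) :=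
    fun i hi => w.adj_getVert_succ hi
  have hn0 : 0 < n := by
    rcases Nat.eq_zero_or_pos n with h | h
    · exact absurd (congrArg f (Walk.eq_of_length_eq_zero (p := w) h)) hne
    · exact h
  have hW : ∀ i ≤ n, w.getVert i ∈ W ∧ (f (w.getVert i) = a ∨ f (w.getVert i) = b) := by
    intro i hi
    rcases hi.eq_or_lt with h | h
    · have := hadj (i-1) (by omega)
      rw [Nat.sub_add_cancel (by omega)] at this
      exact ⟨this.2.2.1, this.2.2.2.2⟩
    · have := hadj i h
      exact ⟨this.2.1, this.2.2.2.1⟩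
  have halt : ∀ i ≤ n, (f (w.getVert i) = f x ↔ Even i) := by
    intro i
    induction i with
    | zero => simp
    | succ i ih =>
      intro hi
      have h1 := ih (by omega)
      have h2 := hadj i (by omega)
      have h3 := hf _ h2.2.1 _ h2.2.2.1 h2.1
      have h4 := (hW 0 (by omega)).2
      rw [Walk.getVert_zero] at h4
      have h5 := (hW i (by omega)).2
      have h6 := (hW (i+1) (by omega)).2
      rw [Nat.even_add_one, ← h1]
      grind
  have hodd : Odd n := by
    rw [← Nat.not_even_iff_odd, ← halt n le_rfl, hn, Walk.getVert_length]
    exact fun h => hne h.symm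
  have hch : ∀ i j, i + 2 ≤ j → j ≤ n → ¬ G.Adj (w.getVert i) (w.getVert j) := by
    intro i j hij hj ha
    have hb : (bi G W f a b).Adj (w.getVert i) (w.getVert j) :=
      ⟨ha, (hW i (by omega)).1, (hW j hj).1, (hW i (by omega)).2, (hW j hj).2⟩
    have := SimpleGraph.dist_le ((w.take i).append (Walk.cons hb (w.drop j)))
    rw [← hw] at this
    simp [Walk.take_length, Walk.drop_length] at this
    omega
  have hall := lemA hG v n w.getVert hodd (fun i hi => (hadj i hi).1)
    (fun i j hi hj h => hp.getVert_injOn (by simpa using hi) (by simpa using hj) h) hch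
    (fun i hi => hv _ (hW i hi).1 (hW i hi).2)
    (by rw [Walk.getVert_zero]; exact ((hN x).1 hx).2)
    (by rw [hn, Walk.getVert_length]; exact ((hN y).1 hy).2)
  have hin : ∀ i ≤ n, w.getVert i ∈ U := by
    intro i
    induction i with
    | zero => simpa using hxU
    | succ i ih =>
      intro hi
      have h2 := hadj i (by omega)
      exact hU _ (ih (by omega)) _ ⟨h2.1, (hN _).2 ⟨h2.2.1, hall i (by omega)⟩,
        (hN _).2 ⟨h2.2.2.1, hall (i+1) hi⟩, h2.2.2.2⟩
  have := hin n le_rfl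
  rwa [hn, Walk.getVert_length] at this

lemma lift {G : SimpleGraph V} (hG : G.IsMeyniel) {W N : Finset V} {K : Finset ℕ}
    {f f₀ g₀ : V → ℕ} {v : V} (hf : Proper G W f) (hN : ∀ x, x ∈ N ↔ x ∈ W ∧ G.Adj v x)
    (hv : ∀ x ∈ W, f x ∈ K → x ≠ v) (hm : Move G N K f₀ g₀) (he : ∀ x ∈ N, f x = f₀ x) :
    ∃ g, Move G W K f g ∧ ∀ x ∈ N, g x = g₀ x := by
  classical
  obtain ⟨a, ha, b, hb, hab, U, hU, h1, h2, h3⟩ := hm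
  have hbi : ∀ x y, (bi G N f a b).Adj x y ↔ (bi G N f₀ a b).Adj x y := by
    intro x y
    simp only [bi]
    constructor
    · rintro ⟨h, hx, hy, h'⟩
      rw [he x hx, he y hy] at h'
      exact ⟨h, hx, hy, h'⟩
    · rintro ⟨h, hx, hy, h'⟩
      rw [← he x hx, ← he y hy] at h'
      exact ⟨h, hx, hy, h'⟩
  have hNW : ∀ x y, (bi G N f a b).Adj x y → (bi G W f a b).Adj x y := by
    rintro x y ⟨h, hx, hy, h'⟩
    exact ⟨h, ((hN x).1 hx).1, ((hN y).1 hy).1, h'⟩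
  have hv' : ∀ x ∈ W, (f x = a ∨ f x = b) → x ≠ v := by
    intro x hx h
    refine hv x hx ?_
    rcases h with h | h <;> rw [h] <;> assumption
  have hcl : ∀ x ∈ U, ∀ y, (bi G N f a b).Adj x y → y ∈ U :=
    fun x hx y h => hU.closed x hx y ((hbi x y).1 h)
  have hUs : ∀ x ∈ U, x ∈ N ∧ (f x = a ∨ f x = b) := by
    intro x hx
    have := hU.sub x hx
    exact ⟨this.1, by rw [he x this.1]; exact this.2⟩
  have hsing : ∀ x ∈ U, ∀ y ∈ N, f y = f x → (∀ z, ¬ (bi G N f a b).Adj x z) →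
      (∀ z, ¬ (bi G N f a b).Adj y z) → y ∈ U := by
    intro x hx y hy hxy hx' hy'
    refine hU.sing x hx y hy ?_ (fun z h => hx' z ((hbi _ _).2 h))
      (fun z h => hy' z ((hbi _ _).2 h))
    rw [← he x (hUs x hx).1, ← he y hy, hxy]
  set U' : Set V := {x | (∃ u ∈ U, (bi G W f a b).Reachable u x) ∨
    (x ∈ W ∧ (∀ z, ¬ (bi G W f a b).Adj x z) ∧
      ∃ u ∈ U, f x = f u ∧ ∀ z, ¬ (bi G W f a b).Adj u z)} with hU'
  have hreach : ∀ u ∈ W, (f u = a ∨ f u = b) → ∀ x, (bi G W f a b).Reachable u x →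
      x ∈ W ∧ (f x = a ∨ f x = b) := by
    intro u hu hu' x hr
    obtain ⟨w⟩ := hr
    induction w with
    | nil => exact ⟨hu, hu'⟩
    | cons h w ih => exact ih h.2.2.1 h.2.2.2.2
  have hgood : Good G W f a b U' := by
    refine ⟨?_, ?_, ?_⟩
    · rintro x (⟨u, hu, hr⟩ | ⟨hx, -, u, hu, hxu, -⟩)
      · exact hreach u ((hN u).1 (hUs u hu).1).1 (hUs u hu).2 x hr
      · exact ⟨hx, by rw [hxu]; exact (hUs u hu).2⟩
    · rintro x (⟨u, hu, hr⟩ | ⟨hx, hx', -⟩) y hxy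
      · exact Or.inl ⟨u, hu, hr.trans hxy.reachable⟩
      · exact absurd hxy (hx' y)
    · rintro x (⟨u, hu, hr⟩ | ⟨hx, hx', u, hu, hxu, hu'⟩) y hy hyx hsx hsy
      · have : x = u := by
          obtain ⟨w⟩ := hr.symm
          cases w with
          | nil => rfl
          | cons h w => exact absurd h (hsx _)
        subst this
        exact Or.inr ⟨hy, hsy, x, hu, hyx, hsx⟩
      · exact Or.inr ⟨hy, hsy, u, hu, hyx.trans hxu, hu'⟩
  have hUU : ∀ x ∈ N, x ∈ U' ↔ x ∈ U := by
    intro x hx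
    constructor
    · rintro (⟨u, hu, hr⟩ | ⟨-, hx', u, hu, hxu, hu'⟩)
      · have huN := (hUs u hu).1
        by_cases hne : f u = f x
        · by_cases hz : ∃ z ∈ N, (bi G W f a b).Reachable u z ∧ f u ≠ f z
          · obtain ⟨z, hz, hrz, hnz⟩ := hz
            have hzU := lemB hG hf hN hv' hcl huN hu hz hrz hnz
            exact lemB hG hf hN hv' hcl hz hzU hx (hrz.symm.trans hr) (by rw [← hne]; exact hnz.symm)
          · push Not at hz
            refine hsing u hu x hx hne.symm ?_ ?_
            · intro z h
              have hz' := hNW _ _ h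
              exact hf _ hz'.2.1 _ hz'.2.2.1 hz'.1 (hz z h.2.2.1 hz'.reachable)
            · intro z h
              have hz' := hNW _ _ h
              exact hf _ hz'.2.1 _ hz'.2.2.1 hz'.1
                (hne.symm.trans (hz z h.2.2.1 (hr.trans hz'.reachable)))
        · exact lemB hG hf hN hv' hcl huN hu hx hr hne
      · exact hsing u hu x hx hxu (fun z h => hu' z (hNW _ _ h)) (fun z h => hx' z (hNW _ _ h))
    · intro h
      exact Or.inl ⟨x, h, Reachable.refl _⟩
  refine ⟨fun x => if x ∈ U' then (if f x = a then b else a) else f x,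
    ⟨a, ha, b, hb, hab, U', hgood, ?_, ?_, ?_⟩, ?_⟩
  · intro x hx; simp [hx]
  · intro x hx h; simp [hx, h]
  · intro x hx h; simp [hx, h, hab.symm]
  · intro x hx
    have e := he x hx
    have s := hU.sub x
    by_cases h : x ∈ U
    · have h' := (hUU x hx).2 h
      simp only [h', if_true]
      grind
    · have h' : x ∉ U' := fun h' => h ((hUU x hx).1 h')
      simp only [h', if_false]
      rw [h1 x h, e]

lemma liftStar {G : SimpleGraph V} (hG : G.IsMeyniel) {W N : Finset V} {K : Finset ℕ}
    {f g₀ : V → ℕ} {v : V} (hf : Proper G W f) (hN : ∀ x, x ∈ N ↔ x ∈ W ∧ G.Adj v x)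
    (hv : ∀ x ∈ W, f x ∈ K → x ≠ v) (hm : ReflTransGen (Move G N K) f g₀) :
    ∃ g, ReflTransGen (Move G W K) f g ∧ (∀ x ∈ N, g x = g₀ x) ∧ Proper G W g ∧
      (∀ K', K ⊆ K' → ∀ x, g x ∈ K' ↔ f x ∈ K') ∧ (∀ c, c ∉ K → ∀ x, g x = c ↔ f x = c) := by
  induction hm with
  | refl => exact ⟨f, .refl, fun _ _ => rfl, hf, fun _ _ _ => Iff.rfl, fun _ _ _ => Iff.rfl⟩
  | tail _ hm ih =>
    obtain ⟨g, h1, h2, h3, h4, h5⟩ := ih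
    obtain ⟨g', m, e⟩ := lift hG h3 hN
      (fun x hx h => hv x hx ((h4 K (Finset.Subset.refl _) x).1 h)) hm h2
    exact ⟨g', h1.tail m, e, m.proper h3, fun K' hK x => (m.mem hK x).trans (h4 K' hK x),
      fun c hc x => (m.eq_of_not_mem hc x).trans (h5 c hc x)⟩

lemma reduce {G : SimpleGraph V} (hG : G.IsMeyniel) (n : ℕ) : ∀ (W : Finset V) (K : Finset ℕ)
    (f : V → ℕ), W.card = n → Proper G W f → (∀ x ∈ W, f x ∈ K) →
    (∀ Q : Finset V, Q ⊆ W → G.IsClique (Q : Set V) → Q.card < K.card) →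
    ∃ g, ReflTransGen (Move G W K) f g ∧ ∃ c ∈ K, ∀ x ∈ W, g x ≠ c := by
  classical
  induction n using Nat.strong_induction_on with
  | _ n ih =>
  intro W K f hn hf hK hQ
  have hK0 : K.Nonempty := by
    rw [← Finset.card_pos]
    have := hQ ∅ (by simp) (by simp)
    omega
  obtain ⟨c, hc⟩ := hK0
  suffices H : ∀ t, ∀ f : V → ℕ, (W.filter (fun x => f x = c)).card = t → Proper G W f →
      (∀ x ∈ W, f x ∈ K) → ∃ g, ReflTransGen (Move G W K) f g ∧ ∃ c ∈ K, ∀ x ∈ W, g x ≠ c from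
    H _ f rfl hf hK
  clear hf hK f
  intro t
  induction t using Nat.strong_induction_on with
  | _ t iht =>
  intro f ht hf hK
  by_cases hemp : ∀ x ∈ W, f x ≠ c
  · exact ⟨f, .refl, c, hc, hemp⟩
  push Not at hemp
  obtain ⟨v, hvW, hvc⟩ := hemp
  set N := W.filter (fun x => G.Adj v x) with hNdef
  have hN : ∀ x, x ∈ N ↔ x ∈ W ∧ G.Adj v x := by intro x; simp [hNdef]
  have hNW : N ⊆ W := Finset.filter_subset _ _
  have hvN : v ∉ N := fun h => G.loopless.irrefl _ ((hN v).1 h).2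
  have hlt : N.card < n := by
    rw [← hn]
    exact Finset.card_lt_card ⟨hNW, fun h => hvN (h hvW)⟩
  obtain ⟨g₀, hg₀, b, hb, hbN⟩ := ih N.card hlt N (K.erase c) f rfl
    (fun x hx y hy h => hf x (hNW hx) y (hNW hy) h)
    (fun x hx => by
      have h := (hN x).1 hx
      exact Finset.mem_erase.2 ⟨fun h' => hf v hvW x h.1 h.2 (hvc.trans h'.symm), hK x h.1⟩)
    (fun Q hQN hcl => by
      have hvQ : v ∉ Q := fun h => hvN (hQN h)
      have := hQ (insert v Q) (Finset.insert_subset hvW (hQN.trans hNW)) (by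
        rw [Finset.coe_insert, SimpleGraph.isClique_insert]
        exact ⟨hcl, fun y hy _ => ((hN y).1 (hQN hy)).2⟩)
      rw [Finset.card_insert_of_notMem hvQ] at this
      rw [Finset.card_erase_of_mem hc]
      omega)
  obtain ⟨g, hg, heq, hgp, hgK, hgc⟩ := liftStar hG hf hN
    (fun x hx h h' => by subst h'; simp [hvc] at h) hg₀
  have hbK := (Finset.mem_erase.1 hb).2
  have hbc := (Finset.mem_erase.1 hb).1
  set U : Set V := {x | x ∈ W ∧ g x = c ∧ ∀ z, ¬ (bi G W g c b).Adj x z} with hU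
  have hgood : Good G W g c b U := by
    refine ⟨fun x hx => ⟨hx.1, Or.inl hx.2.1⟩, fun x hx y h => absurd h (hx.2.2 y), ?_⟩
    intro x hx y hy hxy _ h
    exact ⟨hy, hxy.trans hx.2.1, h⟩
  set g' : V → ℕ := fun x => if x ∈ U then b else g x with hg'
  have hmove : Move G W K g g' := by
    refine ⟨c, hc, b, hbK, hbc.symm, U, hgood, ?_, ?_, ?_⟩
    · intro x hx; simp [hg', hx]
    · intro x hx _; simp [hg', hx]
    · intro x hx h; exact absurd (h.symm.trans hx.2.1) hbc
  have hvU : v ∈ U := by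
    have hgv : g v = c := (hgc c (by simp) v).2 hvc
    refine ⟨hvW, hgv, ?_⟩
    rintro z ⟨hz, -, hzW, -, hz'⟩
    rcases hz' with h | h
    · exact hgp v hvW z hzW hz (hgv.trans h.symm)
    · have hzN := (hN z).2 ⟨hzW, hz⟩
      exact hbN z hzN ((heq z hzN).symm.trans h)
  have hstar : ReflTransGen (Move G W K) f g' :=
    (ReflTransGen.mono (fun _ _ h => h.mono (Finset.erase_subset _ _)) _ _ hg).tail hmove
  have hcard : (W.filter (fun x => g' x = c)).card < t := by
    rw [← ht]
    apply Finset.card_lt_card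
    constructor
    · intro x hx
      simp only [Finset.mem_filter] at hx ⊢
      refine ⟨hx.1, (hgc c (by simp) x).1 ?_⟩
      have := hx.2
      simp only [hg'] at this
      split_ifs at this with h
      · exact h.2.1
      · exact this
    · intro h
      have : v ∈ W.filter (fun x => g' x = c) := h (by simp [hvW, hvc])
      simp [hg', hvU, hbc] at this
  obtain ⟨r, hr, hr'⟩ := iht _ hcard g' rfl (hmove.proper hgp)
    (fun x hx => (hmove.mem (Finset.Subset.refl _) x).2
      ((hgK K (Finset.erase_subset _ _) x).2 (hK x hx)))
  exact ⟨r, hstar.trans hr, hr'⟩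

lemma colors {G : SimpleGraph V} (hG : G.IsMeyniel) (k : ℕ) (W : Finset V)
    (hk : ∀ Q : Finset V, Q ⊆ W → G.IsClique (Q : Set V) → Q.card ≤ k) :
    ∃ f : V → ℕ, Proper G W f ∧ ∀ x ∈ W, f x ∈ Finset.range k := by
  classical
  induction W using Finset.induction_on with
  | empty => exact ⟨fun _ => 0, by simp [Proper], by simp⟩
  | insert v W hvW ih =>
  obtain ⟨f, hf, hfk⟩ := ih (fun Q hQ => hk Q (hQ.trans (Finset.subset_insert _ _)))
  set N := W.filter (fun x => G.Adj v x) with hNdef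
  have hN : ∀ x, x ∈ N ↔ x ∈ W ∧ G.Adj v x := by intro x; simp [hNdef]
  have hNW : N ⊆ W := Finset.filter_subset _ _
  have hvN : v ∉ N := fun h => hvW (hNW h)
  obtain ⟨g₀, hg₀, b, hb, hbN⟩ := reduce hG N.card N (Finset.range k) f rfl
    (fun x hx y hy h => hf x (hNW hx) y (hNW hy) h) (fun x hx => hfk x (hNW hx))
    (fun Q hQN hcl => by
      have hvQ : v ∉ Q := fun h => hvN (hQN h)
      have := hk (insert v Q) (Finset.insert_subset_insert _ (hQN.trans hNW)) (by
        rw [Finset.coe_insert, SimpleGraph.isClique_insert]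
        exact ⟨hcl, fun y hy _ => ((hN y).1 (hQN hy)).2⟩)
      rw [Finset.card_insert_of_notMem hvQ] at this
      rw [Finset.card_range]
      omega)
  obtain ⟨g, hg, heq, hgp, hgK, hgc⟩ := liftStar hG hf hN
    (fun x hx _ h' => by subst h'; exact hvW hx) hg₀
  have hgv : ∀ y ∈ W, G.Adj v y → g y ≠ b := fun y hy h => by
    have := (hN y).2 ⟨hy, h⟩
    rw [heq y this]; exact hbN y this
  refine ⟨Function.update g v b, ?_, ?_⟩
  · intro x hx y hy hxy
    rcases Finset.mem_insert.1 hx with rfl | hx'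
    · rcases Finset.mem_insert.1 hy with rfl | hy
      · exact absurd hxy (G.loopless.irrefl _)
      · rw [Function.update_self, Function.update_of_ne hxy.ne']
        exact (hgv y hy hxy).symm
    · have hxv : x ≠ v := fun h => hvW (h ▸ hx')
      rcases Finset.mem_insert.1 hy with rfl | hy
      · rw [Function.update_self, Function.update_of_ne hxv]
        exact hgv x hx' hxy.symm
      · have hyv : y ≠ v := fun h => hvW (h ▸ hy)
        rw [Function.update_of_ne hxv, Function.update_of_ne hyv]
        exact hgp x hx' y hy hxy
  · intro x hx
    rcases Finset.mem_insert.1 hx with rfl | hx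
    · rw [Function.update_self]; exact hb
    · have hxv : x ≠ v := fun h => hvW (h ▸ hx)
      rw [Function.update_of_ne hxv]
      exact (hgK _ (Finset.Subset.refl _) x).2 (hfk x hx)

end MeynielProof

theorem meyniel_chromaticNumber_eq_cliqueNum {V : Type*} [Fintype V]
    (G : SimpleGraph V) (hG : G.IsMeyniel) :
    G.chromaticNumber = G.cliqueNum := by
  apply le_antisymm
  · obtain ⟨f, hf, hfk⟩ := MeynielProof.colors hG G.cliqueNum Finset.univ
      (fun Q _ hQ => hQ.card_le_cliqueNum)
    refine SimpleGraph.Colorable.chromaticNumber_le ?_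
    exact ⟨SimpleGraph.Coloring.mk
      (fun x => (⟨f x, Finset.mem_range.1 (hfk x (Finset.mem_univ _))⟩ : Fin G.cliqueNum))
      (fun {x y} h h' => hf x (Finset.mem_univ _) y (Finset.mem_univ _) h (Fin.mk.inj_iff.1 h'))⟩
  · exact SimpleGraph.cliqueNum_le_chromaticNumber
end

section
/- Every Meyniel graph is perfect: if G is a finite simple graph in which every odd cycle of length at least five has at least two chords, then for every induced subgraph H of G the chromatic number of H equals the clique number of H. -/
open SimpleGraph

namespace Meyn
variable {V : Type*}

lemma base_bad {G : SimpleGraph V} (hG : G.IsMeyniel) (n : ℕ) (hn : Odd n) (h5 : 5 ≤ n)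
    (f : ℕ → V) (inj : ∀ i j, i < n → j < n → f i = f j → i = j)
    (adj : ∀ i, i + 1 < n → G.Adj (f i) (f (i+1))) (adj0 : G.Adj (f (n-1)) (f 0)) (p q : ℕ)
    (chord : ∀ i j, i < n → j < n → G.Adj (f i) (f j) →
      i + 1 = j ∨ j + 1 = i ∨ i + 1 = j + n ∨ j + 1 = i + n ∨ (i = p ∧ j = q) ∨ (i = q ∧ j = p)) :
    False := by
  obtain ⟨m, rfl⟩ : ∃ m, n = m + 3 := ⟨n - 3, by omega⟩
  have key : ∀ u v : Fin (m+3), (u - v).val = 1 → G.Adj (f u) (f v) := by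
    intro u v h
    rcases Nat.lt_or_ge u.val v.val with h1 | h1
    · rw [Fin.coe_sub_iff_lt.mpr (by exact h1)] at h
      have : u.val = 0 := by omega
      have h2 : v.val = m + 3 - 1 := by omega
      rw [this, h2]; exact adj0.symm
    · rw [Fin.sub_val_of_le (by exact h1)] at h
      have : u.val = v.val + 1 := by omega
      rw [this]; exact (adj _ (by omega)).symm
  let φ : cycleGraph (m+3) →g G :=
    { toFun := fun i => f i.val
      map_rel' := by
        intro u v h
        rcases cycleGraph_adj'.1 h with h | h
        · exact key u v h
        · exact (key v u h).symm }
  have φinj : Function.Injective φ := fun u v h => Fin.ext (inj _ _ u.2 v.2 h)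
  let c := (cycleGraph.cycle m).map φ
  have hc : c.IsCycle := (Walk.isCycle_map_iff_of_injective φinj).2 cycleGraph.isCycle_cycle
  have hlen : c.length = m + 3 := by simp [c]
  have hgv : ∀ k, k ≤ m + 3 → c.getVert k = f ((m + 3 - k) % (m+3)) := by
    intro k hk
    simp only [c, Walk.getVert_map]
    rw [cycleGraph.getVert_cycle hk]; rfl
  have h2 := hG c hc (by rw [hlen]; exact hn) (by rw [hlen]; exact h5)
  have hed : ∀ k, k < m + 3 → s(c.getVert k, c.getVert (k+1)) ∈ c.edges := by
    intro k hk
    exact (Walk.mk_mem_edges_iff_exists _).2 ⟨k, by omega, rfl⟩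
  have e1 : ∀ i, i + 1 < m + 3 → s(f i, f (i+1)) ∈ c.edges := by
    intro i hi
    have := hed (m + 3 - (i+1)) (by omega)
    rw [hgv _ (by omega), hgv _ (by omega)] at this
    rw [show m + 3 - (m + 3 - (i+1)) = i+1 by omega, show m + 3 - (m + 3 - (i+1) + 1) = i by omega,
      Nat.mod_eq_of_lt hi, Nat.mod_eq_of_lt (by omega), Sym2.eq_swap] at this
    exact this
  have e2 : s(f 0, f (m+2)) ∈ c.edges := by
    have := hed 0 (by omega)
    rw [hgv _ (by omega), hgv _ (by omega)] at this
    simpa [Nat.mod_eq_of_lt (show m + 2 < m + 3 by omega)] using this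
  have hsub : G.cycleChords c ⊆ {s(f p, f q)} := by
    intro e he
    obtain ⟨he1, he2, he3⟩ := he
    induction e with
    | _ a b =>
    have ha := he2 a (by simp)
    have hb := he2 b (by simp)
    have hs : ∀ a ∈ c.support, ∃ i, i < m + 3 ∧ a = f i := by
      intro a ha
      obtain ⟨k, hk, hk2⟩ := Walk.mem_support_iff_exists_getVert.1 ha
      exact ⟨(m+3-k) % (m+3), Nat.mod_lt _ (by omega), by rw [← hk, hgv _ (by omega)]⟩
    obtain ⟨i, hi, rfl⟩ := hs a ha
    obtain ⟨j, hj, rfl⟩ := hs b hb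
    rcases chord i j hi hj he1 with h | h | h | h | h | h
    · subst h; exact absurd (e1 _ hj) he3
    · subst h; rw [Sym2.eq_swap] at he3; exact absurd (e1 _ hi) he3
    · obtain rfl : j = 0 := by omega
      obtain rfl : i = m + 2 := by omega
      rw [Sym2.eq_swap] at he3; exact absurd e2 he3
    · obtain rfl : i = 0 := by omega
      obtain rfl : j = m + 2 := by omega
      exact absurd e2 he3
    · rw [h.1, h.2]; rfl
    · rw [h.1, h.2, Sym2.eq_swap]; rfl
  have := Set.ncard_le_ncard hsub (Set.finite_singleton _)
  rw [Set.ncard_singleton] at this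
  omega

/-- `f 0, …, f (n-1)` is an induced cycle. -/
def Hole (H : SimpleGraph V) (n : ℕ) (f : ℕ → V) : Prop :=
  ∀ i j, i < n → j < n → (f i = f j → i = j) ∧
    (H.Adj (f i) (f j) ↔ i + 1 = j ∨ j + 1 = i ∨ i + 1 = j + n ∨ j + 1 = i + n)

/-- `p 0, …, p k` is an induced path. -/
def IndPath (H : SimpleGraph V) (k : ℕ) (p : ℕ → V) : Prop :=
  ∀ i j, i ≤ k → j ≤ k → (p i = p j → i = j) ∧
    (H.Adj (p i) (p j) ↔ i + 1 = j ∨ j + 1 = i)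

/-- no odd holes -/
def Q1 (H : SimpleGraph V) : Prop := ∀ n f, Odd n → 5 ≤ n → ¬ Hole H n f

/-- no even hole with an ear at an edge satisfying `C`. -/
def Q2 (H : SimpleGraph V) (C : V → Prop) : Prop :=
  ∀ n f r, Even n → 4 ≤ n → Hole H n f → (∀ i, i < n → (H.Adj r (f i) ↔ i = 0 ∨ i = 1)) →
    C (f 0) → C (f 1) → False

lemma ear_ne {H : SimpleGraph V} {n f r} (h4 : 4 ≤ n) (hf : Hole H n f) {a : ℕ} (ha : a + 1 < n)
    (hr : ∀ i, i < n → (H.Adj r (f i) ↔ i = a ∨ i = a + 1)) : ∀ i, i < n → r ≠ f i := by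
  rintro i hi rfl
  have h0 := hr a (by omega)
  have h1 := hr (a+1) (by omega)
  rw [(hf i a hi (by omega)).2] at h0
  rw [(hf i (a+1) hi (by omega)).2] at h1
  omega

lemma base_Q1 {G : SimpleGraph V} (hG : G.IsMeyniel) : Q1 G := by
  intro n f hn h5 hf
  refine base_bad hG n hn h5 f (fun i j hi hj => (hf i j hi hj).1) ?_ ?_ 0 0 ?_
  · intro i hi; rw [(hf _ _ (by omega) hi).2]; omega
  · rw [(hf _ _ (by omega) (by omega)).2]; omega
  · intro i j hi hj h; rw [(hf _ _ hi hj).2] at h; omega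

lemma base_Q2 {G : SimpleGraph V} (hG : G.IsMeyniel) : Q2 G (fun _ => True) := by
  intro n f r hn h4 hf hr _ _
  have hne := ear_ne h4 hf (a := 0) (by omega) (by simpa using hr)
  -- cycle r, f 1, ..., f (n-1), f 0
  let g : ℕ → V := fun i => if i = 0 then r else if i < n then f i else f 0
  have g0 : g 0 = r := by simp [g]
  have g1 : ∀ i, 0 < i → i < n → g i = f i := by
    intro i h h'; simp [g, h', show i ≠ 0 by omega]
  have g2 : g n = f 0 := by simp [g, show n ≠ 0 by omega]
  have cs : ∀ i, i < n + 1 → (i = 0 ∧ g i = r) ∨ (0 < i ∧ i < n ∧ g i = f i) ∨ (i = n ∧ g i = f 0) := by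
    intro i hi
    rcases Nat.eq_zero_or_pos i with h | h
    · left; exact ⟨h, h ▸ g0⟩
    · rcases Nat.lt_or_ge i n with h' | h'
      · exact Or.inr (Or.inl ⟨h, h', g1 i h h'⟩)
      · have : i = n := by omega
        exact Or.inr (Or.inr ⟨this, this ▸ g2⟩)
  have hrs : ∀ i, i < n → (G.Adj (f i) r ↔ i = 0 ∨ i = 1) := fun i hi => by
    rw [G.adj_comm]; exact hr i hi
  refine base_bad hG (n+1) hn.add_one (by omega) g ?_ ?_ ?_ 1 n ?_
  · intro i j hi hj h
    rcases cs i hi with ⟨a, b⟩ | ⟨a, a', b⟩ | ⟨a, b⟩ <;> rcases cs j hj with ⟨c, d⟩ | ⟨c, c', d⟩ | ⟨c, d⟩ <;> rw [b, d] at h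
    · omega
    · exact absurd h (hne _ c')
    · exact absurd h (hne _ (by omega))
    · exact absurd h.symm (hne _ a')
    · exact (hf _ _ a' c').1 h
    · have := (hf _ _ a' (by omega)).1 h; omega
    · exact absurd h.symm (hne _ (by omega))
    · have := (hf _ _ (by omega) c').1 h; omega
    · omega
  · intro i hi
    rcases cs i (by omega) with ⟨a, b⟩ | ⟨a, a', b⟩ | ⟨a, b⟩ <;> rcases cs (i+1) hi with ⟨c, d⟩ | ⟨c, c', d⟩ | ⟨c, d⟩ <;> rw [b, d] <;> try omega
    · rw [hr _ c']; omega
    · rw [(hf _ _ a' c').2]; omega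
    · rw [(hf _ _ a' (by omega)).2]; omega
  · rw [g0, Nat.add_sub_cancel, g2, hrs _ (by omega)]; omega
  · intro i j hi hj h
    rcases cs i hi with ⟨a, b⟩ | ⟨a, a', b⟩ | ⟨a, b⟩ <;> rcases cs j hj with ⟨c, d⟩ | ⟨c, c', d⟩ | ⟨c, d⟩ <;> rw [b, d] at h
    · exact absurd h (G.loopless.irrefl _)
    · rw [hr _ c'] at h; omega
    · omega
    · rw [hrs _ a'] at h; omega
    · rw [(hf _ _ a' c').2] at h; omega
    · rw [(hf _ _ a' (by omega)).2] at h; omega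
    · omega
    · rw [(hf _ _ (by omega) c').2] at h; omega
    · exact absurd h (G.loopless.irrefl _)

lemma Hole.rot {H : SimpleGraph V} {n f} (hf : Hole H n f) (k : ℕ) (hk : k < n) :
    Hole H n (fun i => if i + k < n then f (i + k) else f (i + k - n)) := by
  intro i j hi hj
  dsimp only
  split_ifs with h1 h2 h2
  · have := hf (i+k) (j+k) h1 h2
    exact ⟨fun h => by have := this.1 h; omega, by rw [this.2]; omega⟩
  · have := hf (i+k) (j+k-n) h1 (by omega)
    exact ⟨fun h => by have := this.1 h; omega, by rw [this.2]; omega⟩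
  · have := hf (i+k-n) (j+k) (by omega) h2
    exact ⟨fun h => by have := this.1 h; omega, by rw [this.2]; omega⟩
  · have := hf (i+k-n) (j+k-n) (by omega) (by omega)
    exact ⟨fun h => by have := this.1 h; omega, by rw [this.2]; omega⟩

/-- ear at an arbitrary place -/
lemma Q2.gen {H : SimpleGraph V} {C : V → Prop} (hQ : Q2 H C) {n f r} (hn : Even n) (h4 : 4 ≤ n)
    (hf : Hole H n f) (a : ℕ) (ha : a + 1 < n)
    (hr : ∀ i, i < n → (H.Adj r (f i) ↔ i = a ∨ i = a + 1)) (h0 : C (f a)) (h1 : C (f (a+1))) :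
    False := by
  refine hQ n _ r hn h4 (hf.rot a (by omega)) ?_ ?_ ?_
  · intro i hi
    split_ifs with h
    · rw [hr _ h]; omega
    · rw [hr _ (by omega)]; omega
  · simpa [show a < n by omega] using h0
  · rw [if_pos (by omega), add_comm]; exact h1

/-- cycle from a tip and a path -/
def tip (d : V) (p : ℕ → V) : ℕ → V
  | 0 => d
  | m + 1 => p m

lemma IndPath.hole {H : SimpleGraph V} {k p} (hp : IndPath H k p) (d : V)
    (hd : ∀ i, i ≤ k → d ≠ p i) (hk : 2 ≤ k) (ha : ∀ i, i ≤ k → (H.Adj d (p i) ↔ i = 0 ∨ i = k)) :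
    Hole H (k+2) (tip d p) := by
  intro i j hi hj
  rcases i with _ | i <;> rcases j with _ | j <;> simp only [tip]
  · simp
  · refine ⟨fun h => absurd h (hd _ (by omega)), ?_⟩
    rw [ha _ (by omega)]; omega
  · refine ⟨fun h => absurd h.symm (hd _ (by omega)), ?_⟩
    rw [H.adj_comm, ha _ (by omega)]; omega
  · refine ⟨fun h => by rw [(hp i j (by omega) (by omega)).1 h], ?_⟩
    rw [(hp i j (by omega) (by omega)).2]; omega

lemma IndPath.sub {H : SimpleGraph V} {k p} (hp : IndPath H k p) (s t : ℕ) (hst : s + t ≤ k) :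
    IndPath H t (fun i => p (s + i)) := by
  intro i j hi hj
  have := hp (s+i) (s+j) (by omega) (by omega)
  exact ⟨fun h => by have := this.1 h; omega, by rw [this.2]; omega⟩

lemma IndPath.rev {H : SimpleGraph V} {k p} (hp : IndPath H k p) :
    IndPath H k (fun i => p (k - i)) := by
  intro i j hi hj
  have := hp (k-i) (k-j) (by omega) (by omega)
  exact ⟨fun h => by have := this.1 h; omega, by rw [this.2]; omega⟩

/-- combinatorics of gaps, upward. -/
lemma gaps_up (P : ℕ → Prop) (k : ℕ) (hk : P k)
    (g2 : ∀ i j, P i → P (i+1) → i + 2 < j → j ≤ k → P j → (∀ m, i + 1 < m → m < j → ¬ P m) → False)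
    (i : ℕ) (hi : P i) (hi1 : P (i+1)) : ∀ j, i ≤ j → j ≤ k → P j := by
  classical
  have : ∀ j, i ≤ j → j + 1 ≤ k → P j ∧ P (j+1) := by
    intro j hj
    induction j, hj using Nat.le_induction with
    | base => intro _; exact ⟨hi, hi1⟩
    | succ j hj ih =>
      intro hk'
      obtain ⟨a, b⟩ := ih (by omega)
      refine ⟨b, ?_⟩
      by_contra hc
      have hex : ∃ t, j + 1 < t ∧ t ≤ k ∧ P t := ⟨k, by omega, le_rfl, hk⟩
      have hs := Nat.find_spec hex
      refine g2 j (Nat.find hex) a b ?_ hs.2.1 hs.2.2 ?_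
      · have : Nat.find hex ≠ j + 2 := fun h => hc (by have := hs.2.2; rwa [h] at this)
        omega
      · intro m h1 h2 h3
        exact Nat.find_min hex h2 ⟨h1, by omega, h3⟩
  intro j h1 h2
  rcases Nat.eq_or_lt_of_le h1 with h | h
  · exact h ▸ hi
  · have := (this (j-1) (by omega) (by omega)).2
    rwa [show j - 1 + 1 = j by omega] at this

lemma gaps (P : ℕ → Prop) (k : ℕ) (h0 : P 0) (hk : P k)
    (g1 : ∀ i j, i + 1 < j → j ≤ k → P i → P j → (∀ m, i < m → m < j → ¬ P m) → Even (j - i))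
    (g2 : ∀ i j, P i → P (i+1) → i + 2 < j → j ≤ k → P j → (∀ m, i + 1 < m → m < j → ¬ P m) → False)
    (g3 : ∀ i j, i + 1 < j → j + 1 ≤ k → P i → P j → P (j+1) → (∀ m, i < m → m < j → ¬ P m) → False) :
    (∀ i, i ≤ k → P i) ∨ (∀ i, i ≤ k → P i → Even i) := by
  classical
  by_cases h : ∃ i, i + 1 ≤ k ∧ P i ∧ P (i+1)
  · left
    obtain ⟨i, hik, hi, hi1⟩ := h
    have up := gaps_up P k hk g2 i hi hi1
    have dn := gaps_up (fun m => m ≤ k → P (k - m)) k (fun _ => by simpa using h0) (by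
      intro a b pa pb hab hb pc hm
      refine g3 (k - b) (k - (a+1)) (by omega) (by omega) (pc (by omega)) (pb (by omega)) ?_ ?_
      · rw [show k - (a+1) + 1 = k - a by omega]; exact pa (by omega)
      · intro m h1 h2 h3
        refine hm (k - m) (by omega) (by omega) fun _ => ?_
        rwa [show k - (k - m) = m by omega]) (k - (i+1))
      (fun _ => by rwa [show k - (k - (i+1)) = i + 1 by omega])
      (fun _ => by rwa [show k - (k - (i+1) + 1) = i by omega])
    intro j hj
    rcases Nat.lt_or_ge j i with h | h
    · have := dn (k - j) (by omega) (by omega) (by omega)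
      rwa [show k - (k - j) = j by omega] at this
    · exact up j h hj
  · right
    push Not at h
    intro i
    induction i using Nat.strong_induction_on with
    | _ i ih =>
    intro hi hP
    rcases Nat.eq_zero_or_pos i with h' | h'
    · simp [h']
    · have hpr : ∃ t, t < i ∧ P (i - 1 - t) := ⟨i - 1, by omega, by simpa using h0⟩
      have hs := Nat.find_spec hpr
      have hmin := fun m hm => Nat.find_min hpr (m := m) hm
      generalize Nat.find hpr = t at hs hmin
      obtain ⟨h1, h2⟩ := hs
      have hgap : ∀ m, i - 1 - t < m → m < i → ¬ P m := by
        intro m a b c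
        exact hmin (i - 1 - m) (by omega) ⟨by omega, by rwa [show i - 1 - (i - 1 - m) = m by omega]⟩
      have e := ih (i - 1 - t) (by omega) (by omega) h2
      have hne : i - 1 - t + 1 ≠ i := fun hh => h (i-1-t) (by omega) h2 (by rwa [hh])
      have e2 := g1 (i-1-t) i (by omega) hi h2 hP hgap
      rw [show i = (i - (i - 1 - t)) + (i - 1 - t) by omega]
      exact e2.add e

lemma gap_hole {H : SimpleGraph V} {k z} (hz : IndPath H k z) {d : V}
    (hd : ∀ i, i ≤ k → d ≠ z i) (i j : ℕ) (hij : i + 1 < j) (hj : j ≤ k)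
    (hi : H.Adj d (z i)) (hj' : H.Adj d (z j)) (hm : ∀ m, i < m → m < j → ¬ H.Adj d (z m)) :
    Hole H (j - i + 2) (tip d (fun m => z (i + m))) := by
  refine (hz.sub i (j-i) (by omega)).hole d (fun m hm => hd _ (by omega)) (by omega) ?_
  intro m hm'
  constructor
  · intro h
    by_contra hc
    exact hm (i+m) (by omega) (by omega) h
  · rintro (rfl | rfl)
    · exact hi
    · rwa [show i + (j - i) = j by omega]

lemma gap1 {H : SimpleGraph V} (q1 : Q1 H) {k z} (hz : IndPath H k z) {d : V}
    (hd : ∀ i, i ≤ k → d ≠ z i) (i j : ℕ) (hij : i + 1 < j) (hj : j ≤ k)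
    (hi : H.Adj d (z i)) (hj' : H.Adj d (z j)) (hm : ∀ m, i < m → m < j → ¬ H.Adj d (z m)) :
    Even (j - i) := by
  by_contra hc
  rw [Nat.not_even_iff_odd] at hc
  obtain ⟨t, ht⟩ := hc
  exact q1 _ _ ⟨t + 1, by omega⟩ (by omega) (gap_hole hz hd i j hij hj hi hj' hm)

lemma gap2 {H : SimpleGraph V} {w : V} (q1 : Q1 H) (q2 : Q2 H (· ≠ w)) {k z} (hz : IndPath H k z)
    {d : V} (hdw : d ≠ w) (hd : ∀ i, i ≤ k → d ≠ z i) (hint : ∀ i, 0 < i → i < k → z i ≠ w)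
    (i j : ℕ) (hi : H.Adj d (z i)) (hi1 : H.Adj d (z (i+1))) (hij : i + 2 < j) (hj : j ≤ k)
    (hj' : H.Adj d (z j)) (hm : ∀ m, i + 1 < m → m < j → ¬ H.Adj d (z m)) : False := by
  have hh := gap_hole hz hd (i+1) j (by omega) hj hi1 hj' hm
  have he := gap1 q1 hz hd (i+1) j (by omega) hj hi1 hj' hm
  refine q2 _ _ (z i) (he.add (by decide)) (by omega) hh ?_ hdw (hint (i+1) (by omega) (by omega))
  intro m hm'
  rcases m with _ | m
  · simp only [tip]; simp [hi.symm]
  · simp only [tip]; rw [(hz _ _ (by omega) (by omega)).2]; omega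

lemma path_lemma {H : SimpleGraph V} {w : V} (q1 : Q1 H) (q2 : Q2 H (· ≠ w)) {k z}
    (hz : IndPath H k z)
    {d : V} (hdw : d ≠ w) (hd : ∀ i, i ≤ k → d ≠ z i) (hint : ∀ i, 0 < i → i < k → z i ≠ w)
    (h0 : H.Adj d (z 0)) (hk : H.Adj d (z k)) :
    (∀ i, i ≤ k → H.Adj d (z i)) ∨ (∀ i, i ≤ k → H.Adj d (z i) → Even i) := by
  refine gaps (fun i => H.Adj d (z i)) k h0 hk (gap1 q1 hz hd) ?_ ?_
  · exact gap2 q1 q2 hz hdw hd hint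
  · intro i j hij hj hi hj' hj1 hm
    refine gap2 q1 q2 hz.rev hdw (fun m _ => hd _ (by omega)) (fun m _ _ => hint _ (by omega) (by omega))
      (k - (j+1)) (k - i) ?_ ?_ (by omega) (by omega) ?_ ?_
    · rwa [show k - (k - (j+1)) = j + 1 by omega]
    · rwa [show k - (k - (j+1) + 1) = j by omega]
    · rwa [show k - (k - i) = i by omega]
    · intro m h1 h2 h3
      exact hm (k - m) (by omega) (by omega) h3

/-- Consequence of the maximal choice of `x`. -/
def MaxW (H : SimpleGraph V) (w x : V) : Prop :=
  ∀ u c, u ≠ w → ¬ H.Adj w u → H.Adj w c → H.Adj u c → ¬ H.Adj x c →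
    ∃ d, H.Adj w d ∧ H.Adj x d ∧ ¬ H.Adj u d

lemma getd {H : SimpleGraph V} {w x : V} (hmax : MaxW H w x) {n z} (hz : IndPath H n z)
    (hn : 4 ≤ n) (h0 : z 0 = x) (hw : z n = w) :
    ∃ d, d ≠ w ∧ (∀ i, i ≤ n → d ≠ z i) ∧ H.Adj d (z 0) ∧ H.Adj d (z n) ∧ ¬ H.Adj d (z (n-2)) := by
  obtain ⟨d, h1, h2, h3⟩ := hmax (z (n-2)) (z (n-1))
    (by rw [← hw]; intro h; have := (hz _ _ (by omega) (by omega)).1 h; omega)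
    (by rw [← hw, (hz _ _ (by omega) (by omega)).2]; omega)
    (by rw [← hw, (hz _ _ (by omega) (by omega)).2]; omega)
    (by rw [(hz _ _ (by omega) (by omega)).2]; omega)
    (by rw [← h0, (hz _ _ (by omega) (by omega)).2]; omega)
  refine ⟨d, h1.ne', ?_, by rw [h0]; exact h2.symm, by rw [hw]; exact h1.symm, fun h => h3 h.symm⟩
  rintro i hi rfl
  rw [← hw, (hz _ _ (by omega) (by omega)).2] at h1
  rw [← h0, (hz _ _ (by omega) (by omega)).2] at h2
  omega

lemma core1 {H : SimpleGraph V} {w x : V} (q1 : Q1 H) (q2 : Q2 H (· ≠ w)) (hmax : MaxW H w x)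
    {n z} (hz : IndPath H n z) (hn : 5 ≤ n) (ho : Odd n) (h0 : z 0 = x) (hw : z n = w) : False := by
  obtain ⟨d, h1, h2, h3, h4, h5⟩ := getd hmax hz (by omega) h0 hw
  rcases path_lemma q1 q2 hz h1 h2 (by
    intro i h h' e; rw [← hw] at e; have := (hz _ _ (by omega) (by omega)).1 e; omega) h3 h4 with h | h
  · exact h5 (h _ (by omega))
  · exact (Nat.not_even_iff_odd.2 ho) (h n le_rfl h4)

/-- last element satisfying `P` up to `i`. -/
lemma exists_last (P : ℕ → Prop) (h0 : P 0) (i : ℕ) :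
    ∃ s, s ≤ i ∧ P s ∧ ∀ m, s < m → m ≤ i → ¬ P m := by
  induction i with
  | zero => exact ⟨0, le_rfl, h0, fun m h1 h2 => by omega⟩
  | succ i ih =>
    by_cases h : P (i+1)
    · exact ⟨i+1, le_rfl, h, fun m h1 h2 => by omega⟩
    · obtain ⟨s, h1, h2, h3⟩ := ih
      refine ⟨s, by omega, h2, fun m h4 h5 => ?_⟩
      rcases Nat.eq_or_lt_of_le h5 with h6 | h6
      · rwa [h6]
      · exact h3 m h4 (by omega)

lemma exists_first (P : ℕ → Prop) (k : ℕ) (hk : P k) (i : ℕ) (hi : i ≤ k) :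
    ∃ s, i ≤ s ∧ s ≤ k ∧ P s ∧ ∀ m, i ≤ m → m < s → ¬ P m := by
  classical
  have hex : ∃ t, i ≤ t ∧ P t := ⟨k, hi, hk⟩
  exact ⟨Nat.find hex, (Nat.find_spec hex).1, Nat.find_min' hex ⟨hi, hk⟩, (Nat.find_spec hex).2,
    fun m h1 h2 h3 => Nat.find_min hex h2 ⟨h1, h3⟩⟩

lemma core2_aux {H : SimpleGraph V} {w : V} (q1 : Q1 H) (q2 : Q2 H (· ≠ w)) {n z}
    (hz : IndPath H n z)
    {d r : V} (hdw : d ≠ w) (hd : ∀ i, i ≤ n → d ≠ z i) (hint : ∀ i, 0 < i → i < n → z i ≠ w)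
    (h0 : H.Adj d (z 0))
    (hev : ∀ i, i ≤ n → H.Adj d (z i) → Even i) (i : ℕ) (hi : 1 ≤ i) (hin : i + 1 < n)
    (hr : ∀ j, j ≤ n → (H.Adj r (z j) ↔ j = i ∨ j = i + 1)) (hrne : ∀ j, j ≤ n → r ≠ z j)
    (hdr : H.Adj d r) (hie : Even i) : False := by
  by_cases hPi : H.Adj d (z i)
  · obtain ⟨s, hs, hPs, hm⟩ := exists_last (fun i => H.Adj d (z i)) h0 (i-1)
    obtain ⟨a, ha⟩ := hie
    obtain ⟨b, hb⟩ := hev s (by omega) hPs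
    have hh := gap_hole hz hd s i (by omega) (by omega) hPs hPi (fun m h1 h2 => hm m h1 (by omega))
    -- ear at d and z i : positions 0 and i - s + 1 ; rotate
    have hh' := hh.rot (i - s + 1) (by omega)
    refine q2 _ _ r ⟨a - b + 1, by omega⟩ (by omega) hh' ?_ ?_ ?_
    · intro m hm'
      split_ifs with h
      · obtain rfl : m = 0 := by omega
        rw [show 0 + (i - s + 1) = (i - s) + 1 by omega]
        simp only [tip]
        rw [show s + (i - s) = i by omega, hr i (by omega)]; simp
      · rcases Nat.lt_or_ge m 2 with h2 | h2
        · obtain rfl : m = 1 := by omega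
          rw [show 1 + (i - s + 1) - (i - s + 2) = 0 by omega]
          simp only [tip]
          simp [hdr.symm]
        · rw [show m + (i - s + 1) - (i - s + 2) = (m - 2) + 1 by omega]
          simp only [tip]
          rw [hr _ (by omega)]; omega
    · rw [if_pos (by omega), show 0 + (i - s + 1) = (i - s) + 1 by omega]
      simp only [tip]
      exact hint _ (by omega) (by omega)
    · rw [if_neg (by omega), show 1 + (i - s + 1) - (i - s + 2) = 0 by omega]
      exact hdw
  · obtain ⟨s, hs, hPs, hm⟩ := exists_last (fun i => H.Adj d (z i)) h0 i
    have hsi : s ≠ i := fun h => hPi (h ▸ hPs)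
    obtain ⟨a, ha⟩ := hie
    obtain ⟨b, hb⟩ := hev s (by omega) hPs
    -- path z s .. z i, r
    have hp : IndPath H (i - s + 1) (fun m => if m ≤ i - s then z (s + m) else r) := by
      intro u v hu hv
      dsimp only
      split_ifs with h1 h2 h2
      · have := hz (s+u) (s+v) (by omega) (by omega)
        exact ⟨fun h => by have := this.1 h; omega, by rw [this.2]; omega⟩
      · refine ⟨fun h => absurd h.symm (hrne _ (by omega)), ?_⟩
        rw [H.adj_comm, hr _ (by omega)]; omega
      · refine ⟨fun h => absurd h (hrne _ (by omega)), ?_⟩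
        rw [hr _ (by omega)]; omega
      · refine ⟨fun _ => by omega, ?_⟩
        simp; omega
    refine q1 (i - s + 1 + 2) _ ⟨a - b + 1, by omega⟩ (by omega) (hp.hole d ?_ (by omega) ?_)
    · intro m hm'
      split_ifs with h
      · exact hd _ (by omega)
      · exact hdr.ne
    · intro m hm'
      split_ifs with h
      · constructor
        · intro h'
          by_contra hc
          exact hm (s+m) (by omega) (by omega) h'
        · rintro (rfl | rfl)
          · exact hPs
          · exfalso; omega
      · simp only [hdr, true_iff]; omega

lemma core2 {H : SimpleGraph V} {w x : V} (q1 : Q1 H) (q2 : Q2 H (· ≠ w)) (hmax : MaxW H w x)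
    {n z} (hz : IndPath H n z) (hn : 4 ≤ n) (he : Even n) (h0 : z 0 = x) (hw : z n = w)
    (r : V) (hrne : ∀ j, j ≤ n → r ≠ z j) (i : ℕ) (hi : 1 ≤ i) (hin : i + 1 < n)
    (hr : ∀ j, j ≤ n → (H.Adj r (z j) ↔ j = i ∨ j = i + 1)) : False := by
  obtain ⟨d, h1, h2, h3, h4, h5⟩ := getd hmax hz (by omega) h0 hw
  have hint : ∀ i, 0 < i → i < n → z i ≠ w := by
    intro i h h' e; rw [← hw] at e; have := (hz _ _ (by omega) (by omega)).1 e; omega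
  rcases path_lemma q1 q2 hz h1 h2 hint h3 h4 with h | hev
  · exact h5 (h _ (by omega))
  by_cases hdr : H.Adj d r
  · obtain ⟨a, ha⟩ := he
    rcases Nat.even_or_odd i with hie | ⟨b, hb⟩
    · exact core2_aux q1 q2 hz h1 h2 hint h3 hev i hi hin hr hrne hdr hie
    · refine core2_aux q1 q2 hz.rev h1 (fun m _ => h2 _ (by omega))
        (fun m _ _ => hint _ (by omega) (by omega)) (by simpa using h4) ?_ (n - (i+1)) (by omega)
        (by omega) ?_ (fun m _ => hrne _ (by omega)) hdr ⟨a - (b + 1), by omega⟩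
      · intro j hj h
        obtain ⟨c, hc⟩ := hev _ (by omega) h
        exact ⟨a - c, by omega⟩
      · intro j hj
        rw [hr _ (by omega)]; omega
  · obtain ⟨s, hs, hPs, hms⟩ := exists_last (fun i => H.Adj d (z i)) h3 i
    obtain ⟨t, ht, htn, hPt, hmt⟩ := exists_first (fun i => H.Adj d (z i)) n h4 (i+1) (by omega)
    obtain ⟨a, ha⟩ := hev s (by omega) hPs
    obtain ⟨b, hb⟩ := hev t (by omega) hPt
    have hh := gap_hole hz h2 s t (by omega) htn hPs hPt (by
      intro m h1 h2
      rcases Nat.lt_or_ge i m with h | h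
      · exact hmt m (by omega) h2
      · exact hms m h1 h)
    refine q2.gen (r := r) ⟨b - a + 1, by omega⟩ (by omega) hh (i - s + 1) (by omega) ?_ ?_ ?_
    · intro m hm
      rcases m with _ | m
      · simp only [tip]; rw [H.adj_comm]; simp [hdr]
      · simp only [tip]; rw [hr _ (by omega)]; omega
    · simp only [tip]; exact hint _ (by omega) (by omega)
    · simp only [tip]; exact hint _ (by omega) (by omega)

lemma noP4 {H : SimpleGraph V} {w x : V} (q1 : Q1 H) (q2 : Q2 H (· ≠ w)) (hmax : MaxW H w x)
    (hxw : x ≠ w) (hnx : ¬ H.Adj w x) (a b : V) (hwa : H.Adj w a) (hab : H.Adj a b) (hbx : H.Adj b x)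
    (hax : ¬ H.Adj a x) (hbw : ¬ H.Adj b w) : False := by
  have hbw' : b ≠ w := by rintro rfl; exact hnx hbx
  obtain ⟨c, h1, h2, h3⟩ := hmax b a hbw' (fun h => hbw h.symm) hwa hab.symm (fun h => hax h.symm)
  have hca : c ≠ a := by rintro rfl; exact hax h2.symm
  have hcb : c ≠ b := by rintro rfl; exact hbw h1.symm
  have hax' : a ≠ x := by rintro rfl; exact hnx hwa
  have e1 := hwa.ne
  have e2 := hab.ne
  have e3 := hbx.ne
  have e4 := h1.ne
  have e5 := h2.ne
  by_cases hac : H.Adj a c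
  · let p : ℕ → V := fun m => if m = 0 then a else if m = 1 then b else x
    have hp : IndPath H 2 p := by
      intro i j hi hj
      interval_cases i <;> interval_cases j <;> simp [p, H.adj_comm, *] <;> grind [SimpleGraph.adj_comm]
    have hh := hp.hole c (by intro i hi; interval_cases i <;> simp [p] <;> grind) le_rfl (by
      intro i hi; interval_cases i <;> simp [p] <;> grind [SimpleGraph.adj_comm])
    refine q2 _ _ w (by decide) (by decide) hh ?_ h1.ne' hwa.ne'
    intro i hi
    interval_cases i <;> simp [tip, p] <;> grind [SimpleGraph.adj_comm]
  · let p : ℕ → V := fun m => if m = 0 then a else if m = 1 then b else if m = 2 then x else c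
    have hp : IndPath H 3 p := by
      intro i j hi hj
      interval_cases i <;> interval_cases j <;> simp [p, *] <;> grind [SimpleGraph.adj_comm]
    have hh := hp.hole w (by intro i hi; interval_cases i <;> simp [p] <;> grind) (by omega) (by
      intro i hi; interval_cases i <;> simp [p] <;> grind [SimpleGraph.adj_comm])
    exact q1 _ _ (by decide) (by decide) hh

/-- contract `x` into `w`; `x` becomes isolated. -/
def contr (H : SimpleGraph V) (w x : V) : SimpleGraph V where
  Adj u v := u ≠ x ∧ v ≠ x ∧ u ≠ v ∧ (H.Adj u v ∨ (u = w ∧ H.Adj x v) ∨ (v = w ∧ H.Adj x u))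
  symm := ⟨fun u v => by
    rintro ⟨h1, h2, h3, h4⟩
    refine ⟨h2, h1, h3.symm, ?_⟩
    rcases h4 with h | h | h
    · exact Or.inl h.symm
    · exact Or.inr (Or.inr h)
    · exact Or.inr (Or.inl h)⟩
  loopless := ⟨fun u h => h.2.2.1 rfl⟩

lemma contr_off {H : SimpleGraph V} {w x u v : V} (h1 : u ≠ w) (h2 : u ≠ x) (h3 : v ≠ w)
    (h4 : v ≠ x) : (contr H w x).Adj u v ↔ H.Adj u v := by
  simp only [contr, h1, h2, h3, h4, ne_eq, not_false_eq_true, true_and, false_and, or_false]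
  exact ⟨fun h => h.2, fun h => ⟨h.ne, h⟩⟩

lemma contr_w {H : SimpleGraph V} {w x v : V} (hxw : x ≠ w) (h3 : v ≠ w)
    (h4 : v ≠ x) : (contr H w x).Adj w v ↔ H.Adj w v ∨ H.Adj x v := by
  simp [contr, h3, h4, hxw.symm, h3.symm]

lemma contr_nex {H : SimpleGraph V} {w x u v : V} (h : (contr H w x).Adj u v) : u ≠ x := h.1

lemma Hole.nex {H : SimpleGraph V} {w x n f} (hf : Hole (contr H w x) n f) (i : ℕ)
    (hi : i < n) : f i ≠ x := by
  rcases Nat.lt_or_ge (i+1) n with h | h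
  · exact contr_nex ((hf i (i+1) hi h).2.2 (by omega))
  · exact contr_nex ((hf i 0 hi (by omega)).2.2 (by omega))

lemma Hole.off {H : SimpleGraph V} {w x n f} (hf : Hole (contr H w x) n f)
    (hw : ∀ i, i < n → f i ≠ w) : Hole H n f := by
  intro i j hi hj
  rw [← contr_off (hw i hi) (hf.nex i hi) (hw j hj) (hf.nex j hj)]
  exact hf i j hi hj

/-- cap a path at both ends -/
lemma cap {H : SimpleGraph V} {w x : V} (hxw : x ≠ w) (hnx : ¬ H.Adj w x) {n : ℕ} (hn : 4 ≤ n)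
    (g : ℕ → V) (hg : ∀ i j, 0 < i → i < n → 0 < j → j < n → (g i = g j → i = j) ∧
      (H.Adj (g i) (g j) ↔ i + 1 = j ∨ j + 1 = i))
    (gw : ∀ i, 0 < i → i < n → g i ≠ w) (gx : ∀ i, 0 < i → i < n → g i ≠ x)
    (aw : ∀ i, 0 < i → i < n → (H.Adj w (g i) ↔ i = n - 1))
    (ax : ∀ i, 0 < i → i < n → (H.Adj x (g i) ↔ i = 1)) :
    ∃ z, IndPath H n z ∧ z 0 = x ∧ z n = w ∧ ∀ i, 0 < i → i < n → z i = g i := by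
  let z : ℕ → V := fun i => if i = 0 then x else if i < n then g i else w
  have z0 : z 0 = x := by simp [z]
  have z1 : ∀ i, 0 < i → i < n → z i = g i := by
    intro i h h'; simp [z, h', show i ≠ 0 by omega]
  have z2 : z n = w := by simp [z, show n ≠ 0 by omega]
  have cs : ∀ i, i ≤ n → (i = 0 ∧ z i = x) ∨ (0 < i ∧ i < n ∧ z i = g i) ∨ (i = n ∧ z i = w) := by
    intro i hi
    rcases Nat.eq_zero_or_pos i with h | h
    · left; exact ⟨h, h ▸ z0⟩
    · rcases Nat.lt_or_ge i n with h' | h'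
      · exact Or.inr (Or.inl ⟨h, h', z1 i h h'⟩)
      · have : i = n := by omega
        exact Or.inr (Or.inr ⟨this, this ▸ z2⟩)
  refine ⟨z, ?_, z0, z2, z1⟩
  have hnx' : ¬ H.Adj x w := fun h => hnx h.symm
  intro i j hi hj
  rcases cs i hi with ⟨a, b⟩ | ⟨a, a', b⟩ | ⟨a, b⟩ <;> rcases cs j hj with ⟨c, d⟩ | ⟨c, c', d⟩ | ⟨c, d⟩ <;> rw [b, d]
  · exact ⟨fun _ => by omega, by simp; omega⟩
  · exact ⟨fun h => absurd h.symm (gx _ c c'), by rw [ax _ c c']; omega⟩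
  · exact ⟨fun h => absurd h hxw, by simp only [hnx', false_iff]; omega⟩
  · exact ⟨fun h => absurd h (gx _ a a'), by rw [H.adj_comm, ax _ a a']; omega⟩
  · exact hg i j a a' c c'
  · exact ⟨fun h => absurd h (gw _ a a'), by rw [H.adj_comm, aw _ a a']; omega⟩
  · exact ⟨fun h => absurd h.symm hxw, by simp only [hnx, false_iff]; omega⟩
  · exact ⟨fun h => absurd h.symm (gw _ c c'), by rw [aw _ c c']; omega⟩
  · exact ⟨fun _ => by omega, by simp; omega⟩

lemma unrot {H : SimpleGraph V} {w x : V} (hxw : x ≠ w) (hnx : ¬ H.Adj w x) {n g} (hn : 4 ≤ n)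
    (hg : Hole (contr H w x) n g) (h0 : g 0 = w) :
    (∃ y, (y = w ∨ y = x) ∧ Hole H n (tip y (fun m => g (m+1)))) ∨
    ∃ z, IndPath H n z ∧ z 0 = x ∧ z n = w ∧
      ((∀ i, 0 < i → i < n → z i = g i) ∨ (∀ i, 0 < i → i < n → z i = g (n - i))) := by
  have gw : ∀ i, 0 < i → i < n → g i ≠ w := by
    intro i h h' e
    rw [← h0] at e
    have := (hg i 0 h' (by omega)).1 e
    omega
  have gx : ∀ i, 0 < i → i < n → g i ≠ x := fun i _ h => hg.nex i h
  have gg : ∀ i j, 0 < i → i < n → 0 < j → j < n → (g i = g j → i = j) ∧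
      (H.Adj (g i) (g j) ↔ i + 1 = j ∨ j + 1 = i) := by
    intro i j h1 h2 h3 h4
    refine ⟨(hg i j h2 h4).1, ?_⟩
    rw [← contr_off (gw i h1 h2) (gx i h1 h2) (gw j h3 h4) (gx j h3 h4), (hg i j h2 h4).2]
    omega
  have wx : ∀ i, 0 < i → i < n → (H.Adj w (g i) ∨ H.Adj x (g i) ↔ i = 1 ∨ i = n - 1) := by
    intro i h1 h2
    have h3 := (hg 0 i (by omega) h2).2
    rw [h0] at h3
    rw [← contr_w hxw (gw i h1 h2) (gx i h1 h2), h3]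
    omega
  have hp : IndPath H (n-2) (fun m => g (m+1)) := by
    intro i j hi hj
    have := gg (i+1) (j+1) (by omega) (by omega) (by omega) (by omega)
    exact ⟨fun h => by have := this.1 h; omega, by rw [this.2]; omega⟩
  have mk : ∀ y, (y = w ∨ y = x) → H.Adj y (g 1) → H.Adj y (g (n-1)) →
      Hole H n (tip y (fun m => g (m+1))) := by
    intro y hy ha hb
    have := hp.hole y ?_ (by omega) ?_
    · rwa [show n - 2 + 2 = n by omega] at this
    · intro i hi
      rcases hy with rfl | rfl
      · exact (gw _ (by omega) (by omega)).symm
      · exact (gx _ (by omega) (by omega)).symm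
    · intro i hi
      constructor
      · intro h
        have := (wx (i+1) (by omega) (by omega)).1 (by
          rcases hy with rfl | rfl
          · exact Or.inl h
          · exact Or.inr h)
        omega
      · rintro (rfl | rfl)
        · exact ha
        · rwa [show n - 2 + 1 = n - 1 by omega]
  have w1 := (wx 1 (by omega) (by omega)).2 (Or.inl rfl)
  have w2 := (wx (n-1) (by omega) (by omega)).2 (Or.inr rfl)
  by_cases A : H.Adj w (g 1) ∧ H.Adj w (g (n-1))
  · exact Or.inl ⟨w, Or.inl rfl, mk w (Or.inl rfl) A.1 A.2⟩
  by_cases B : H.Adj x (g 1) ∧ H.Adj x (g (n-1))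
  · exact Or.inl ⟨x, Or.inr rfl, mk x (Or.inr rfl) B.1 B.2⟩
  right
  by_cases C : H.Adj x (g 1)
  · have C1 : ¬ H.Adj x (g (n-1)) := fun h => B ⟨C, h⟩
    have C2 : H.Adj w (g (n-1)) := w2.resolve_right C1
    have C3 : ¬ H.Adj w (g 1) := fun h => A ⟨h, C2⟩
    obtain ⟨z, h1, h2, h3, h4⟩ := cap hxw hnx hn g gg gw gx (by
      intro i hi hi'
      constructor
      · intro h
        rcases (wx i hi hi').1 (Or.inl h) with rfl | h'
        · exact absurd h C3
        · exact h'
      · rintro rfl; exact C2) (by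
      intro i hi hi'
      constructor
      · intro h
        rcases (wx i hi hi').1 (Or.inr h) with h' | rfl
        · exact h'
        · exact absurd h C1
      · rintro rfl; exact C)
    exact ⟨z, h1, h2, h3, Or.inl h4⟩
  · have C2 : H.Adj w (g 1) := w1.resolve_right C
    have C1 : ¬ H.Adj w (g (n-1)) := fun h => A ⟨C2, h⟩
    have C3 : H.Adj x (g (n-1)) := w2.resolve_left C1
    obtain ⟨z, h1, h2, h3, h4⟩ := cap hxw hnx hn (fun i => g (n - i)) (by
      intro i j a b c d
      have := gg (n-i) (n-j) (by omega) (by omega) (by omega) (by omega)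
      exact ⟨fun h => by have := this.1 h; omega, by rw [this.2]; omega⟩)
      (fun i _ _ => gw _ (by omega) (by omega)) (fun i _ _ => gx _ (by omega) (by omega)) (by
      intro i hi hi'
      constructor
      · intro h
        rcases (wx (n-i) (by omega) (by omega)).1 (Or.inl h) with h' | h'
        · omega
        · rw [h'] at h; exact absurd h C1
      · rintro rfl; rwa [show n - (n-1) = 1 by omega]) (by
      intro i hi hi'
      constructor
      · intro h
        rcases (wx (n-i) (by omega) (by omega)).1 (Or.inr h) with h' | h'
        · rw [h'] at h; exact absurd h C
        · omega
      · rintro rfl; exact C3)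
    exact ⟨z, h1, h2, h3, Or.inr h4⟩

lemma step1 {H : SimpleGraph V} {w x : V} (q1 : Q1 H) (q2 : Q2 H (· ≠ w)) (hmax : MaxW H w x)
    (hxw : x ≠ w) (hnx : ¬ H.Adj w x) : Q1 (contr H w x) := by
  intro n f hn h5 hf
  by_cases hw : ∃ k, k < n ∧ f k = w
  · obtain ⟨k, hk, hkw⟩ := hw
    rcases unrot hxw hnx (by omega) (hf.rot k hk) (by simpa [hk] using hkw) with
      ⟨y, _, hy⟩ | ⟨z, h1, h2, h3, _⟩
    · exact q1 n _ hn h5 hy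
    · exact core1 q1 q2 hmax h1 h5 hn h2 h3
  · push Not at hw
    exact q1 n f hn h5 (hf.off hw)

lemma step2 {H : SimpleGraph V} {w x : V} (q1 : Q1 H) (q2 : Q2 H (· ≠ w)) (hmax : MaxW H w x)
    (hxw : x ≠ w) (hnx : ¬ H.Adj w x) : Q2 (contr H w x) (· ≠ w) := by
  intro n f r hn h4 hf hr c0 c1
  have hrx : r ≠ x := contr_nex ((hr 0 (by omega)).2 (Or.inl rfl))
  have hrne := ear_ne h4 hf (a := 0) (by omega) (by simpa using hr)
  by_cases hw : ∃ k, k < n ∧ f k = w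
  · obtain ⟨k, hk, hkw⟩ := hw
    have hk2 : 2 ≤ k := by
      by_contra hc
      have : k = 0 ∨ k = 1 := by omega
      rcases this with rfl | rfl
      · exact c0 hkw
      · exact c1 hkw
    have hrw : r ≠ w := by rw [← hkw]; exact hrne k hk
    have hrot := hf.rot k hk
    -- abstract the rotated hole
    obtain ⟨g, hg, g0, a, ha, ha1, hra, hrg⟩ : ∃ g, Hole (contr H w x) n g ∧ g 0 = w ∧ ∃ a, 1 ≤ a ∧
        a + 1 < n ∧ (∀ i, i < n → ((contr H w x).Adj r (g i) ↔ i = a ∨ i = a + 1)) ∧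
        (∀ i, i < n → r ≠ g i) := by
      refine ⟨_, hrot, by simpa [hk] using hkw, n - k, by omega, by omega, ?_, ?_⟩
      · intro i hi
        split_ifs with h
        · rw [hr _ h]; omega
        · rw [hr _ (by omega)]; omega
      · intro i hi
        split_ifs with h
        · exact hrne _ h
        · exact hrne _ (by omega)
    have gw : ∀ i, 0 < i → i < n → g i ≠ w := by
      intro i h h' e
      rw [← g0] at e
      have := (hg i 0 h' (by omega)).1 e
      omega
    have gx : ∀ i, 0 < i → i < n → g i ≠ x := fun i _ h => hg.nex i h
    have hra' : ∀ i, 0 < i → i < n → (H.Adj r (g i) ↔ i = a ∨ i = a + 1) := by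
      intro i hi hi'
      rw [← contr_off hrw hrx (gw i hi hi') (gx i hi hi')]
      exact hra i hi'
    have hrwx : ¬ (H.Adj w r ∨ H.Adj x r) := by
      have h3 := hra 0 (by omega)
      rw [g0] at h3
      rw [← contr_w hxw hrw hrx, SimpleGraph.adj_comm, h3]
      omega
    push Not at hrwx
    have hrwx1 : ¬ H.Adj r w := fun h => hrwx.1 h.symm
    have hrwx2 : ¬ H.Adj r x := fun h => hrwx.2 h.symm
    rcases unrot hxw hnx h4 hg g0 with ⟨y, hy, hy'⟩ | ⟨z, h1, h2, h3, h⟩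
    · refine q2.gen (r := r) hn h4 hy' a ha1 ?_ ?_ ?_
      · intro i hi
        rcases i with _ | i
        · simp only [tip]
          have : ¬ H.Adj r y := by rcases hy with rfl | rfl <;> assumption
          simp only [this, false_iff]; omega
        · simp only [tip]; exact hra' _ (by omega) hi
      · obtain ⟨b, rfl⟩ : ∃ b, a = b + 1 := ⟨a - 1, by omega⟩
        exact gw _ (by omega) (by omega)
      · exact gw _ (by omega) (by omega)
    · have cs : ∀ j, j ≤ n → j = 0 ∨ j = n ∨ (0 < j ∧ j < n) := by intro j hj; omega
      rcases h with h | h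
      · refine core2 q1 q2 hmax h1 h4 hn h2 h3 r ?_ a ha ha1 ?_
        · intro j hj
          rcases cs j hj with rfl | rfl | ⟨h5, h6⟩
          · rwa [h2]
          · rwa [h3]
          · rw [h j h5 h6]; exact hrg j h6
        · intro j hj
          rcases cs j hj with rfl | rfl | ⟨h5, h6⟩
          · rw [h2]; simp only [hrwx2, false_iff]; omega
          · rw [h3]; simp only [hrwx1, false_iff]; omega
          · rw [h j h5 h6, hra' j h5 h6]
      · refine core2 q1 q2 hmax h1 h4 hn h2 h3 r ?_ (n - (a+1)) (by omega) (by omega) ?_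
        · intro j hj
          rcases cs j hj with rfl | rfl | ⟨h5, h6⟩
          · rwa [h2]
          · rwa [h3]
          · rw [h j h5 h6]; exact hrg _ (by omega)
        · intro j hj
          rcases cs j hj with rfl | rfl | ⟨h5, h6⟩
          · rw [h2]; simp only [hrwx2, false_iff]; omega
          · rw [h3]; simp only [hrwx1, false_iff]; omega
          · rw [h j h5 h6, hra' _ (by omega) (by omega)]; omega
  · push Not at hw
    have hf' := hf.off hw
    by_cases hrw : r = w
    · subst hrw
      have hwx : ∀ i, i < n → (H.Adj r (f i) ∨ H.Adj x (f i) ↔ i = 0 ∨ i = 1) := by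
        intro i hi
        rw [← contr_w hxw (hw i hi) (hf.nex i hi)]
        exact hr i hi
      have k0 := (hwx 0 (by omega)).2 (Or.inl rfl)
      have k1 := (hwx 1 (by omega)).2 (Or.inr rfl)
      have a01 : H.Adj (f 0) (f 1) := (hf' 0 1 (by omega) (by omega)).2.2 (Or.inl rfl)
      by_cases A : H.Adj r (f 0) ∧ H.Adj r (f 1)
      · refine q2 n f r hn h4 hf' ?_ c0 c1
        intro i hi
        refine ⟨fun h => (hwx i hi).1 (Or.inl h), ?_⟩
        rintro (rfl | rfl)
        · exact A.1
        · exact A.2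
      by_cases B : H.Adj x (f 0) ∧ H.Adj x (f 1)
      · refine q2 n f x hn h4 hf' ?_ c0 c1
        intro i hi
        refine ⟨fun h => (hwx i hi).1 (Or.inr h), ?_⟩
        rintro (rfl | rfl)
        · exact B.1
        · exact B.2
      by_cases C : H.Adj r (f 0)
      · have C1 : ¬ H.Adj r (f 1) := fun h => A ⟨C, h⟩
        have C2 := k1.resolve_left C1
        have C3 : ¬ H.Adj x (f 0) := fun h => B ⟨h, C2⟩
        exact noP4 q1 q2 hmax hxw hnx (f 0) (f 1) C a01 C2.symm (fun h => C3 h.symm) (fun h => C1 h.symm)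
      · have C2 := k0.resolve_left C
        have C1 : ¬ H.Adj x (f 1) := fun h => B ⟨C2, h⟩
        have C3 := k1.resolve_right C1
        exact noP4 q1 q2 hmax hxw hnx (f 1) (f 0) C3 a01.symm C2.symm (fun h => C1 h.symm) (fun h => C h.symm)
    · refine q2 n f r hn h4 hf' ?_ c0 c1
      intro i hi
      rw [← contr_off hrw hrx (hw i hi) (hf.nex i hi)]
      exact hr i hi

lemma strong_stable [Fintype V] (N : ℕ) : ∀ (H : SimpleGraph V) (w : V) (A : Finset V), A.card = N →
    w ∈ A → (∀ v, v ∉ A → ∀ u, ¬ H.Adj u v) → Q1 H → Q2 H (· ≠ w) →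
    ∃ S : Set V, S ⊆ A ∧ w ∈ S ∧ (∀ u ∈ S, ∀ v ∈ S, ¬ H.Adj u v) ∧
      ∀ K : Set V, K ⊆ A → (∀ u ∈ K, ∀ v ∈ K, u ≠ v → H.Adj u v) →
        (∀ v ∈ A, v ∉ K → ∃ k ∈ K, ¬ H.Adj v k) → ∃ s ∈ S, s ∈ K := by
  classical
  induction N with
  | zero => intro H w A hA hw; simp at hA; simp [hA] at hw
  | succ N ih =>
    intro H w A hA hwA hdead q1 q2
    let cand := A.filter (fun u => u ≠ w ∧ ¬ H.Adj w u)
    by_cases hc : cand.Nonempty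
    · let φ : V → ℕ := fun u => (Finset.univ.filter (fun c => H.Adj w c ∧ H.Adj u c)).card
      obtain ⟨x, hx, hxm⟩ := cand.exists_max_image φ hc
      obtain ⟨hxA, hxw, hnx⟩ : x ∈ A ∧ x ≠ w ∧ ¬ H.Adj w x := by simpa [cand] using hx
      have hmax : MaxW H w x := by
        intro u c huw hwu hwc huc hxc
        by_contra hno
        push Not at hno
        have huA : u ∈ A := by
          by_contra h; exact hdead u h c huc.symm
        have h1 := hxm u (by simp [cand, huA, huw, hwu])
        have h2 : φ x < φ u := by
          apply Finset.card_lt_card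
          rw [Finset.ssubset_iff_of_subset]
          · exact ⟨c, by simp [hwc, huc], by simp [hxc]⟩
          · intro d hd
            simp only [Finset.mem_filter, Finset.mem_univ, true_and] at hd ⊢
            exact ⟨hd.1, hno d hd.1 hd.2⟩
        omega
      obtain ⟨S, hSA, hwS, hst, hhit⟩ := ih (contr H w x) w (A.erase x)
        (by rw [Finset.card_erase_of_mem hxA]; omega) (by simp [hwA, hxw.symm]) (by
          intro v hv u h
          by_cases hvx : v = x
          · exact h.2.1 hvx
          · have hvA : v ∉ A := fun h' => hv (by simp [hvx, h'])
            have hvw : v ≠ w := by rintro rfl; exact hvA hwA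
            rcases h.2.2.2 with h | h | h
            · exact hdead v hvA _ h
            · exact hdead v hvA _ h.2
            · exact hvw h.1) (step1 q1 q2 hmax hxw hnx) (step2 q1 q2 hmax hxw hnx)
      have hxS : ∀ s ∈ S, s ≠ x := by
        rintro s hs rfl
        have := hSA hs
        simp at this
      have hxs : ∀ s ∈ S, ¬ H.Adj x s := by
        intro s hs h
        by_cases hsw : s = w
        · subst hsw; exact hnx h.symm
        · exact hst w hwS s hs ((contr_w hxw hsw (hxS s hs)).2 (Or.inr h))
      refine ⟨insert x S, ?_, Set.mem_insert_of_mem _ hwS, ?_, ?_⟩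
      · intro v hv
        rcases hv with rfl | hv
        · exact hxA
        · exact Finset.mem_of_mem_erase (hSA hv)
      · rintro u (rfl | hu) v (rfl | hv) h
        · exact h.ne rfl
        · exact hxs v hv h
        · exact hxs u hu h.symm
        · exact hst u hu v hv ⟨hxS u hu, hxS v hv, h.ne, Or.inl h⟩
      · intro K hKA hK hKm
        by_contra hno
        push Not at hno
        have hxK : x ∉ K := hno x (Set.mem_insert _ _)
        have hwK : w ∉ K := hno w (Set.mem_insert_of_mem _ hwS)
        have kx : ∀ k ∈ K, k ≠ x := by rintro k hk rfl; exact hxK hk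
        have kw : ∀ k ∈ K, k ≠ w := by rintro k hk rfl; exact hwK hk
        obtain ⟨s, hs, hsK⟩ := hhit K
          (by intro v hv; simp only [Finset.coe_erase]; exact ⟨hKA hv, kx v hv⟩)
          (fun u hu v hv huv => (contr_off (kw u hu) (kx u hu) (kw v hv) (kx v hv)).2 (hK u hu v hv huv))
          (by
            intro v hv hvK
            have hvx : v ≠ x := (Finset.mem_erase.1 hv).1
            have hvA : v ∈ A := (Finset.mem_erase.1 hv).2
            by_cases hvw : v = w
            · subst hvw
              by_contra hall
              push Not at hall
              have hall' : ∀ k ∈ K, H.Adj v k ∨ H.Adj x k := fun k hk =>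
                (contr_w hxw (kw k hk) (kx k hk)).1 (hall k hk)
              obtain ⟨b, hb, hb'⟩ := hKm v hvA hvK
              obtain ⟨a, ha, ha'⟩ := hKm x hxA hxK
              have hb2 := (hall' b hb).resolve_left hb'
              have ha2 := (hall' a ha).resolve_right ha'
              have hab : a ≠ b := by rintro rfl; exact hb' ha2
              exact noP4 q1 q2 hmax hxw hnx a b ha2 (hK a ha b hb hab) hb2.symm
                (fun h => ha' h.symm) (fun h => hb' h.symm)
            · obtain ⟨k, hk, hk'⟩ := hKm v hvA hvK
              exact ⟨k, hk, fun h => hk' ((contr_off hvw hvx (kw k hk) (kx k hk)).1 h)⟩)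
        exact hno s (Set.mem_insert_of_mem _ hs) hsK
    · refine ⟨{w}, by simpa using hwA, rfl, by simp, ?_⟩
      intro K hKA hK hKm
      refine ⟨w, rfl, ?_⟩
      by_contra hwK
      obtain ⟨k, hk, hk'⟩ := hKm w hwA hwK
      exact hc ⟨k, by
        simp only [cand, Finset.mem_filter]
        exact ⟨hKA hk, by rintro rfl; exact hwK hk, hk'⟩⟩

lemma Q1.induce {G : SimpleGraph V} (h : Q1 G) (s : Set V) : Q1 (G.induce s) := by
  intro n f hn h5 hf
  refine h n (fun i => (f i).1) hn h5 fun i j hi hj => ⟨fun e => (hf i j hi hj).1 (Subtype.ext e), ?_⟩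
  rw [← (hf i j hi hj).2]; rfl

lemma Q2.induce {G : SimpleGraph V} (h : Q2 G (fun _ => True)) (s : Set V) :
    Q2 (G.induce s) (fun _ => True) := by
  intro n f r hn h4 hf hr _ _
  refine h n (fun i => (f i).1) r.1 hn h4
    (fun i j hi hj => ⟨fun e => (hf i j hi hj).1 (Subtype.ext e), ?_⟩) ?_ trivial trivial
  · rw [← (hf i j hi hj).2]; rfl
  · intro i hi; rw [← hr i hi]; rfl

lemma colorable (k : ℕ) : ∀ (V : Type*) [Fintype V] (G : SimpleGraph V), Q1 G →
    Q2 G (fun _ => True) → G.CliqueFree (k+1) → G.Colorable k := by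
  classical
  induction k with
  | zero =>
    intro V _ G _ _ h
    have : IsEmpty V := ⟨fun v => h {v} (by simp [isNClique_iff])⟩
    exact ⟨Coloring.mk (fun v => isEmptyElim v) (fun {v} => isEmptyElim v)⟩
  | succ k ih =>
    intro V _ G q1 q2 h
    rcases isEmpty_or_nonempty V with hV | ⟨⟨w⟩⟩
    · exact ⟨Coloring.mk (fun v => isEmptyElim v) (fun {v} => isEmptyElim v)⟩
    obtain ⟨S, _, _, hst, hhit⟩ := strong_stable _ G w Finset.univ rfl (Finset.mem_univ _)
      (fun v hv => absurd (Finset.mem_univ v) hv) q1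
      (fun n f r a b c d _ _ => q2 n f r a b c d trivial trivial)
    have hcf : (G.induce Sᶜ).CliqueFree (k+1) := by
      intro t ht
      let t' : Finset V := t.map (Function.Embedding.subtype _)
      have hcl : ∀ u ∈ t', ∀ v ∈ t', u ≠ v → G.Adj u v := by
        intro u hu v hv huv
        obtain ⟨a, ha, rfl⟩ := Finset.mem_map.1 hu
        obtain ⟨b, hb, rfl⟩ := Finset.mem_map.1 hv
        exact ht.isClique ha hb (fun e => huv (by rw [e]))
      have hcard : t'.card = k + 1 := by rw [Finset.card_map]; exact ht.card_eq
      obtain ⟨s, hs, hst'⟩ := hhit (t' : Set V) (by simp) (fun u hu v hv => hcl u hu v hv) (by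
        intro v _ hv
        by_contra hno
        push Not at hno
        refine h (insert v t') ⟨?_, by rw [Finset.card_insert_of_notMem (by simpa using hv), hcard]⟩
        intro a ha b hb hab
        simp only [Finset.coe_insert, Set.mem_insert_iff] at ha hb
        rcases ha with rfl | ha <;> rcases hb with rfl | hb
        · exact absurd rfl hab
        · exact hno b hb
        · exact (hno a ha).symm
        · exact hcl a ha b hb hab)
      obtain ⟨a, ha, rfl⟩ := Finset.mem_map.1 hst'
      exact a.2 hs
    obtain ⟨c⟩ := ih _ (G.induce Sᶜ) (q1.induce _) (q2.induce _) hcf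
    refine ⟨Coloring.mk (fun v => if hv : v ∈ S then Fin.last k else (c ⟨v, hv⟩).castSucc) ?_⟩
    intro u v huv
    by_cases hu : u ∈ S <;> by_cases hv : v ∈ S
    · exact absurd huv (hst u hu v hv)
    · simp only [hu, hv, dite_true, dite_false]
      exact (Fin.castSucc_lt_last _).ne'
    · simp only [hu, hv, dite_true, dite_false]
      exact (Fin.castSucc_lt_last _).ne
    · simp only [hu, hv, dite_false]
      intro e
      have hh : (G.induce Sᶜ).Adj ⟨u, hu⟩ ⟨v, hv⟩ := huv
      exact c.valid hh (Fin.castSucc_injective _ e)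

end Meyn

/-- Every Meyniel graph is perfect: every induced subgraph has chromatic number
equal to its clique number. -/
theorem meyniel_isPerfect {V : Type*} [Fintype V]
    (G : SimpleGraph V) (hG : G.IsMeyniel) :
    ∀ s : Set V, (G.induce s).chromaticNumber = (G.induce s).cliqueNum := by
  classical
  intro s
  refine le_antisymm ?_ cliqueNum_le_chromaticNumber
  refine chromaticNumber_le_iff_colorable.2 (Meyn.colorable _ _ _ ((Meyn.base_Q1 hG).induce s)
    ((Meyn.base_Q2 hG).induce s) ?_)
  intro t ht
  have := IsClique.card_le_cliqueNum (tc := ht.isClique)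
  rw [ht.card_eq] at this
  omega
end

section
/- For any finite simple graph G, either G contains a Meyniel obstruction, or G contains a clique and a proper vertex coloring of the same size (i.e., the chromatic number of G equals its clique number), or both. -/
open SimpleGraph

/-- A Meyniel obstruction in `G` is an odd cycle of length at least five with
at most one chord. -/
def SimpleGraph.HasMeynielObstruction {V : Type*} (G : SimpleGraph V) : Prop :=
  ∃ (u : V) (c : G.Walk u u), c.IsCycle ∧ Odd c.length ∧ 5 ≤ c.length ∧
    (G.cycleChords c).ncard ≤ 1


namespace Mey

/-- a sequence of `N` distinct vertices forming an odd cycle with at most the chord `(a,b)` -/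
structure BadSeq {V : Type*} (H : SimpleGraph V) (N : ℕ) (c : ℕ → V) (a b : ℕ) : Prop where
  odd : Odd N
  five : 5 ≤ N
  inj : ∀ i j, i < j → j < N → c i ≠ c j
  step : ∀ i, i + 1 < N → H.Adj (c i) (c (i+1))
  close : H.Adj (c (N-1)) (c 0)
  chord : ∀ i j, i < j → j < N → H.Adj (c i) (c j) →
    j = i + 1 ∨ (i = 0 ∧ j = N - 1) ∨ (i = a ∧ j = b)

def Inv {V : Type*} (H : SimpleGraph V) (w : V) : Prop :=
  ∀ N c a b, BadSeq H N c a b →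
    ((∀ i < N, c i ≠ w) ∨ (c 0 = w ∧ 0 < a)) → False

theorem exists_walk {V : Type*} (G : SimpleGraph V) (c : ℕ → V) (n : ℕ)
    (h : ∀ i < n, G.Adj (c i) (c (i+1))) :
    ∃ p : G.Walk (c 0) (c n), p.length = n ∧ p.support = (List.range (n+1)).map c ∧
      p.edges = (List.range n).map (fun i => s(c i, c (i+1))) := by
  induction n with
  | zero => exact ⟨Walk.nil, by simp⟩
  | succ n ih =>
    obtain ⟨p, h1, h2, h3⟩ := ih (fun i hi => h i (by omega))
    refine ⟨p.concat (h n (by omega)), by simp [h1], ?_, ?_⟩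
    · rw [Walk.support_concat, h2, List.range_succ (n := n+1)]; simp
    · rw [Walk.edges_concat, h3, List.range_succ (n := n)]; simp

theorem BadSeq.obstruction {V : Type*} {G : SimpleGraph V} {N : ℕ} {c : ℕ → V} {a b : ℕ}
    (h : BadSeq G N c a b) : G.HasMeynielObstruction := by
  obtain ⟨n, rfl⟩ : ∃ n, N = n + 1 := ⟨N - 1, by have := h.five; omega⟩
  have h5 := h.five
  obtain ⟨p, h1, h2, h3⟩ := exists_walk G c n (fun i hi => h.step i (by omega))
  have hcl : G.Adj (c n) (c 0) := h.close
  have inj : ∀ i j, i < n + 1 → j < n + 1 → c i = c j → i = j := by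
    intro i j hi hj hij
    rcases lt_trichotomy i j with hl | hl | hl
    · exact absurd hij (h.inj i j hl hj)
    · exact hl
    · exact absurd hij.symm (h.inj j i hl hi)
  refine ⟨c n, Walk.cons hcl p, ?_, ?_, ?_, ?_⟩
  · rw [Walk.cons_isCycle_iff]
    constructor
    · rw [Walk.isPath_def, h2]
      apply List.Nodup.map_on _ List.nodup_range
      intro x hx y hy hxy
      exact inj x y (by simpa using hx) (by simpa using hy) hxy
    · rw [h3]
      simp only [List.mem_map, List.mem_range, not_exists, not_and]
      intro i hi he
      rw [Sym2.eq_iff] at he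
      rcases he with ⟨e1, e2⟩ | ⟨e1, e2⟩
      · have := inj _ _ (by omega) (by omega) e1; omega
      · have := inj _ _ (by omega) (by omega) e1
        have := inj _ _ (by omega) (by omega) e2
        omega
  · simpa [h1] using h.odd
  · simp [h1]; omega
  · have hsub : G.cycleChords (Walk.cons hcl p) ⊆ {s(c a, c b)} := by
      intro e
      induction e using Sym2.ind with
      | _ x y =>
      rintro ⟨he, hs, hne⟩
      have key : ∀ i j, i < j → j < n + 1 → G.Adj (c i) (c j) →
          s(c i, c j) ∉ (Walk.cons hcl p).edges → s(c i, c j) = s(c a, c b) := by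
        intro i j hij hj hadj hn
        rw [Walk.edges_cons, h3] at hn
        rcases h.chord i j hij hj hadj with r | ⟨r1, r2⟩ | ⟨r1, r2⟩
        · exfalso; apply hn
          subst r
          simp only [List.mem_cons, List.mem_map, List.mem_range]
          exact Or.inr ⟨i, by omega, rfl⟩
        · exfalso; apply hn
          subst r1 r2
          simp [Sym2.eq_swap]
        · rw [r1, r2]
      have mem : ∀ x, x ∈ (Walk.cons hcl p).support → ∃ i < n + 1, c i = x := by
        intro x hx
        rw [Walk.support_cons, h2] at hx
        simp only [List.mem_cons, List.mem_map, List.mem_range] at hx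
        rcases hx with rfl | hx
        · exact ⟨n, by omega, rfl⟩
        · exact hx
      obtain ⟨i, hi, rfl⟩ := mem x (hs x (by simp))
      obtain ⟨j, hj, rfl⟩ := mem y (hs y (by simp))
      have hadj : G.Adj (c i) (c j) := he
      simp only [Set.mem_singleton_iff]
      rcases lt_trichotomy i j with hl | hl | hl
      · exact key i j hl hj hadj hne
      · subst hl; exact absurd hadj (G.irrefl)
      · rw [Sym2.eq_swap] at hne ⊢
        exact key j i hl hi hadj.symm hne
    calc _ ≤ ({s(c a, c b)} : Set (Sym2 V)).ncard := Set.ncard_le_ncard hsub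
      _ = 1 := by simp

/-- closing a path `f 0, ..., f l` by a vertex `u` -/
theorem Inv.close {V : Type*} {H : SimpleGraph V} {w : V} (hI : Inv H w)
    (f : ℕ → V) (l a b : ℕ) (u : V) (hl : Odd l) (h3 : 3 ≤ l)
    (inj : ∀ i j, i < j → j ≤ l → f i ≠ f j)
    (hu : ∀ i ≤ l, f i ≠ u)
    (step : ∀ i < l, H.Adj (f i) (f (i+1)))
    (ch : ∀ i j, i < j → j ≤ l → H.Adj (f i) (f j) → j = i + 1 ∨ (i = a ∧ j = b))
    (u0 : H.Adj u (f 0)) (ul : H.Adj u (f l))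
    (uch : ∀ i ≤ l, H.Adj u (f i) → i = 0 ∨ i = l ∨ (i = a ∧ b = l + 1))
    (hw : ∀ i, 1 ≤ i → i ≤ l → f i ≠ w) (huw : u ≠ w) (ha : f 0 = w → 0 < a) : False := by
  classical
  refine hI (l+2) (fun i => if i ≤ l then f i else u) a b ?_ ?_
  · refine ⟨by grind, by omega, ?_, ?_, ?_, ?_⟩
    · intro i j hij hj
      by_cases h : j ≤ l
      · simpa [h, show i ≤ l by omega] using inj i j hij h
      · simpa [h, show i ≤ l by omega] using hu i (by omega)
    · intro i hi
      by_cases h : i + 1 ≤ l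
      · simpa [h, show i ≤ l by omega] using step i (by omega)
      · have : i = l := by omega
        subst this
        simpa using ul.symm
    · simpa using u0
    · intro i j hij hj
      by_cases h : j ≤ l
      · simp only [h, show i ≤ l by omega, if_true]
        intro hh
        have := ch i j hij h hh
        tauto
      · simp only [h, show i ≤ l by omega, if_true, if_false]
        intro hh
        have := uch i (by omega) hh.symm
        omega
  · by_cases h : f 0 = w
    · right; simpa [h] using ha h
    · left
      intro i hi
      by_cases hil : i ≤ l
      · simp only [hil, if_true]
        rcases Nat.eq_zero_or_pos i with rfl | h0
        · exact h
        · exact hw i h0 hil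
      · simpa [hil] using huw

theorem next_nbr {P : ℕ → Prop} {s m : ℕ} (hsm : s < m) (hm : P m) :
    ∃ k, s < k ∧ k ≤ m ∧ P k ∧ ∀ i, s < i → i < k → ¬ P i := by
  classical
  have hex : ∃ k, s < k ∧ P k := ⟨m, hsm, hm⟩
  refine ⟨Nat.find hex, (Nat.find_spec hex).1, Nat.find_min' hex ⟨hsm, hm⟩,
    (Nat.find_spec hex).2, ?_⟩
  intro i hi hik hP
  exact Nat.find_min hex hik ⟨hi, hP⟩

/-- an induced odd path whose ends see `u` is complete to `u` -/
theorem Inv.complete {V : Type*} {H : SimpleGraph V} {w : V} (hI : Inv H w) (u : V)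
    (huw : u ≠ w) (m : ℕ) : ∀ (f : ℕ → V) (_ : Odd m)
    (_ : ∀ i j, i < j → j ≤ m → f i ≠ f j)
    (_ : ∀ i ≤ m, f i ≠ u)
    (_ : ∀ i < m, H.Adj (f i) (f (i+1)))
    (_ : ∀ i j, i < j → j ≤ m → H.Adj (f i) (f j) → j = i + 1)
    (_ : H.Adj u (f 0)) (_ : H.Adj u (f m))
    (_ : ∀ i, 1 ≤ i → i ≤ m → f i ≠ w), ∀ i ≤ m, H.Adj u (f i) := by
  induction m using Nat.strong_induction_on with
  | _ m ih =>
  intro f hodd inj hu step ch u0 um hw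
  have IH : ∀ k, 0 < k → k ≤ m → Odd (m - k) → H.Adj u (f k) →
      ∀ i, k ≤ i → i ≤ m → H.Adj u (f i) := by
    intro k hk0 hkm hkodd huk i hi him
    have := ih (m - k) (by omega) (fun i => f (k + i)) hkodd
      (fun i j hij hj => inj _ _ (by omega) (by omega))
      (fun i hi => hu _ (by omega))
      (fun i hi => step _ (by omega))
      (fun i j hij hj hh => by have := ch _ _ (by omega) (by omega) hh; omega)
      huk (by simpa [show k + (m - k) = m by omega] using um)
      (fun i hi him => hw _ (by omega) (by omega)) (i - k) (by omega)
    simpa [show k + (i - k) = i by omega] using this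
  -- closing a segment
  have C : ∀ s t a b, Odd (t - s) → s + 3 ≤ t → t ≤ m → H.Adj u (f s) → H.Adj u (f t) → 0 < a →
      (∀ i, s < i → i < t → H.Adj u (f i) → i = s + a ∧ b = t - s + 1) → False := by
    intro s t a b hto hst htm hus hut ha hc
    refine hI.close (fun i => f (s + i)) (t - s) a b u hto (by omega)
      (fun i j hij hj => inj _ _ (by omega) (by omega))
      (fun i hi => hu _ (by omega))
      (fun i hi => step _ (by omega))
      (fun i j hij hj hh => by have := ch _ _ (by omega) (by omega) hh; omega)
      hus (by simpa [show s + (t - s) = t by omega] using hut) ?_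
      (fun i hi him => hw _ (by omega) (by omega)) huw (fun _ => ha)
    intro i hi hh
    by_cases h1 : i = 0
    · exact Or.inl h1
    by_cases h2 : i = t - s
    · exact Or.inr (Or.inl h2)
    have := hc (s + i) (by omega) (by omega) hh
    omega
  have hm1 : 0 < m := by grind
  obtain ⟨k, hk0, hkm, huk, hkn⟩ := next_nbr (P := fun i => H.Adj u (f i)) hm1 um
  rcases Nat.even_or_odd k with hev | hod
  · exfalso
    have hkm' : k < m := by grind
    have h1 := IH k hk0 hkm (by grind) huk (k+1) (by omega) (by omega)
    refine C 0 (k+1) k (k+2) (by grind) (by grind) (by omega) u0 h1 hk0 ?_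
    intro i hi hik hui
    have : ¬ i < k := fun h => hkn i hi h hui
    omega
  · by_cases hk1 : k = 1
    · subst hk1
      by_cases hm : m = 1
      · subst hm
        intro i hi
        interval_cases i
        · exact u0
        · exact um
      obtain ⟨t, ht1, htm, hut, htn⟩ := next_nbr (P := fun i => H.Adj u (f i))
        (show 1 < m by omega) um
      by_cases ht2 : t = 2
      · subst ht2
        intro i hi
        rcases Nat.lt_or_ge i 2 with h | h
        · interval_cases i
          · exact u0
          · exact huk
        · exact IH 2 (by omega) htm (by grind) hut i h hi
      exfalso
      rcases Nat.even_or_odd t with htev | htod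
      · exact C 1 t 1 0 (by grind) (by grind) htm huk hut one_pos
          (fun i h1 h2 h3 => absurd h3 (htn i h1 h2))
      · refine C 0 t 1 (t + 1) (by grind) (by grind) htm u0 hut one_pos ?_
        intro i h1 h2 h3
        have : ¬ 1 < i := fun h => htn i h h2 h3
        omega
    · exfalso
      exact C 0 k 1 0 (by simpa using hod) (by grind) hkm u0 huk one_pos
        (fun i h1 h2 h3 => absurd h3 (hkn i h1 h2))

end Mey

namespace Mey

/-- a path with exactly one chord `(a,b)` whose ends see `u`: then `u` is complete to the
path obtained by using the chord as a shortcut. -/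
theorem Inv.complete_chord {V : Type*} {H : SimpleGraph V} {w : V} (hI : Inv H w) (u : V)
    (huw : u ≠ w) (m : ℕ) (f : ℕ → V) (a b : ℕ) (hodd : Odd m)
    (inj : ∀ i j, i < j → j ≤ m → f i ≠ f j)
    (hu : ∀ i ≤ m, f i ≠ u)
    (step : ∀ i < m, H.Adj (f i) (f (i+1)))
    (ch : ∀ i j, i < j → j ≤ m → H.Adj (f i) (f j) → j = i + 1 ∨ (i = a ∧ j = b))
    (u0 : H.Adj u (f 0)) (um : H.Adj u (f m))
    (hw : ∀ i, 1 ≤ i → i ≤ m → f i ≠ w)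
    (ha : 1 ≤ a) (hab : a + 2 ≤ b) (hb : b + 1 ≤ m) (hadj : H.Adj (f a) (f b)) :
    ∀ i ≤ m, (i ≤ a ∨ b ≤ i) → H.Adj u (f i) := by
  -- the shortcut
  obtain ⟨d, hd⟩ : ∃ d, b = a + d + 1 := ⟨b - a - 1, by omega⟩
  obtain ⟨σ, hσ1, hσ2⟩ : ∃ σ : ℕ → ℕ, (∀ i ≤ a, σ i = i) ∧ (∀ i, a < i → σ i = i + d) :=
    ⟨fun i => if i ≤ a then i else i + d, fun i hi => by simp [hi],
      fun i hi => by simp [show ¬ i ≤ a by omega]⟩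
  have hσ : ∀ i, (i ≤ a ∧ σ i = i) ∨ (a < i ∧ σ i = i + d) := by
    intro i
    rcases Nat.lt_or_ge a i with h | h
    · exact Or.inr ⟨h, hσ2 i h⟩
    · exact Or.inl ⟨h, hσ1 i h⟩
  have σinv : ∀ i, (i ≤ a ∨ b ≤ i) → ∃ k, σ k = i := by
    rintro i (h | h)
    · exact ⟨i, hσ1 i h⟩
    · exact ⟨i - d, by rw [hσ2 _ (by omega)]; omega⟩
  -- subpaths of the shortcut
  have S : ∀ s t, s < t → t ≤ m - d → Odd (t - s) → H.Adj u (f (σ s)) → H.Adj u (f (σ t)) →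
      ∀ i, s ≤ i → i ≤ t → H.Adj u (f (σ i)) := by
    intro s t hst htm hto hus hut i hi hit
    have := hI.complete u huw (t - s) (fun i => f (σ (s + i))) hto
      (fun i j hij hj => inj _ _ (by have := hσ (s+i); have := hσ (s+j); omega)
        (by have := hσ (s+j); omega))
      (fun i hi => hu _ (by have := hσ (s+i); omega))
      (fun i hi => by
        show H.Adj (f (σ (s + i))) (f (σ (s + i + 1)))
        rcases lt_trichotomy (s + i) a with h | h | h
        · rw [hσ1 _ h.le, hσ1 _ h]
          exact step _ (by omega)
        · rw [hσ1 _ h.le, hσ2 _ (by omega), h, show a + 1 + d = b by omega]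
          exact hadj
        · rw [hσ2 _ h, hσ2 _ (by omega), show s + i + 1 + d = s + i + d + 1 by omega]
          exact step _ (by omega))
      (fun i j hij hj hh => by
        have h1 := hσ (s+i)
        have h2 := hσ (s+j)
        have := ch _ _ (by omega) (by omega) hh
        omega)
      hus (by simpa [show s + (t - s) = t by omega] using hut)
      (fun i hi him => hw _ (by have := hσ (s+i); omega) (by have := hσ (s+i); omega))
      (i - s) (by omega)
    simpa [show s + (i - s) = i by omega] using this
  have hσ0 : σ 0 = 0 := hσ1 0 (by omega)
  have hσm : σ (m - d) = m := by rw [hσ2 _ (by omega)]; omega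
  rcases Nat.even_or_odd d with hde | hdo
  · -- the shortcut is odd
    intro i him hi
    obtain ⟨k, rfl⟩ := σinv i hi
    exact S 0 (m - d) (by omega) le_rfl (by grind) (by rwa [hσ0]) (by rwa [hσm]) k (by omega)
      (by have := hσ k; omega)
  by_cases hd1 : d = 1
  swap
  · -- the chord gives an odd hole
    exfalso
    refine hI.close (fun i => f (a + i)) d 1 0 (f b) hdo (by grind)
      (fun i j hij hj => inj _ _ (by omega) (by omega))
      (fun i hi => inj _ _ (by omega) (by omega))
      (fun i hi => step _ (by omega))
      (fun i j hij hj hh => by have := ch _ _ (by omega) (by omega) hh; omega)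
      hadj.symm ?_ ?_
      (fun i hi him => hw _ (by omega) (by omega)) (hw _ (by omega) (by omega)) (fun _ => one_pos)
    · have := step (a + d) (by omega)
      rw [hd]
      exact this.symm
    · intro i hi hh
      have := ch _ _ (by omega) (by omega) hh.symm
      omega
  subst hd1
  by_cases hex : ∃ k, k ≤ m - 1 ∧ Odd k ∧ H.Adj u (f (σ k))
  · obtain ⟨k, hkm, hk, huk⟩ := hex
    intro i him hi
    obtain ⟨j, rfl⟩ := σinv i hi
    have hj : j ≤ m - 1 := by have := hσ j; omega
    rcases Nat.lt_or_ge k j with h | h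
    · have h2 : k < m - 1 := by omega
      exact S k (m-1) h2 le_rfl (by grind) huk (by rwa [hσm]) j h.le hj
    · exact S 0 k (by grind) hkm (by simpa using hk) (by rwa [hσ0]) huk j (by omega) h
  exfalso
  have n1 : ∀ i ≤ a, H.Adj u (f i) → Even i := by
    intro i hi hui
    by_contra hne
    exact hex ⟨i, by omega, by grind, by rwa [hσ1 i hi]⟩
  have n2 : ∀ i ≤ m, b ≤ i → H.Adj u (f i) → Odd i := by
    intro i him hi hui
    by_contra hne
    refine hex ⟨i - 1, by omega, by grind, ?_⟩
    rw [hσ2 _ (by omega), show i - 1 + 1 = i by omega]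
    exact hui
  by_cases hmid : H.Adj u (f (a+1))
  · rcases Nat.even_or_odd a with hae | hao
    · have := hI.complete u huw (a+1) f (by grind)
        (fun i j hij hj => inj _ _ (by omega) (by omega))
        (fun i hi => hu _ (by omega))
        (fun i hi => step _ (by omega))
        (fun i j hij hj hh => by have := ch _ _ (by omega) (by omega) hh; omega)
        u0 hmid (fun i hi him => hw _ (by omega) (by omega)) 1 (by omega)
      have := n1 1 (by omega) this
      grind
    · have := hI.complete u huw (m-(a+1)) (fun i => f (a + 1 + i)) (by grind)
        (fun i j hij hj => inj _ _ (by omega) (by omega))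
        (fun i hi => hu _ (by omega))
        (fun i hi => step _ (by omega))
        (fun i j hij hj hh => by have := ch _ _ (by omega) (by omega) hh; omega)
        hmid (by simpa [show a + 1 + (m - (a+1)) = m by omega] using um)
        (fun i hi him => hw _ (by omega) (by omega)) 2 (by omega)
      have := n2 (a+1+2) (by omega) (by omega) this
      grind
  · obtain ⟨t, ht1, htm, hut, htn⟩ := next_nbr (P := fun i => H.Adj u (f i))
      (show a + 1 < m by omega) um
    obtain ⟨s', hs1, hsm, hus, hsn⟩ := next_nbr (P := fun i => H.Adj u (f (a + 1 - i)))
      (show 0 < a + 1 by omega) (by simpa using u0)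
    obtain ⟨s, hs⟩ : ∃ s, s = a + 1 - s' := ⟨_, rfl⟩
    rw [← hs] at hus
    have e1 := n1 s (by omega) hus
    have e2 := n2 t htm (by omega) hut
    refine hI.close (fun i => f (s + i)) (t - s) (a - s) (b - s) u (by grind)
      (by obtain ⟨q, hq⟩ := e1; obtain ⟨r, hr⟩ := e2; omega)
      (fun i j hij hj => inj _ _ (by omega) (by omega))
      (fun i hi => hu _ (by omega))
      (fun i hi => step _ (by omega))
      (fun i j hij hj hh => by have := ch _ _ (by omega) (by omega) hh; omega)
      hus (by simpa [show s + (t - s) = t by omega] using hut) ?_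
      (fun i hi him => hw _ (by omega) (by omega)) huw ?_
    · intro i hi hui
      by_contra hcon
      rcases lt_trichotomy (s + i) (a+1) with h | h | h
      · refine hsn (a + 1 - (s + i)) (by omega) (by omega) ?_
        rwa [show a + 1 - (a + 1 - (s + i)) = s + i by omega]
      · rw [h] at hui; exact hmid hui
      · exact htn (s + i) h (by omega) hui
    · intro h0
      have : ¬ 1 ≤ s := fun h => hw s h (by omega) h0
      omega

theorem Inv.core {V : Type*} {H : SimpleGraph V} {w z : V} (hI : Inv H w)
    (hmax : ∀ t p, t ≠ w → ¬ H.Adj w t → H.Adj w p → H.Adj t p → ¬ H.Adj z p →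
      ∃ u, H.Adj w u ∧ H.Adj z u ∧ ¬ H.Adj t u)
    (m : ℕ) (f : ℕ → V) (a b : ℕ) (hodd : Odd m) (h3 : 3 ≤ m)
    (f0 : f 0 = w) (fm : f m = z)
    (inj : ∀ i j, i < j → j ≤ m → f i ≠ f j)
    (step : ∀ i < m, H.Adj (f i) (f (i+1)))
    (ch : ∀ i j, i < j → j ≤ m → H.Adj (f i) (f j) → j = i + 1 ∨ (i = a ∧ j = b))
    (hw : ∀ i ≤ m, H.Adj w (f i) → i = 1)
    (hz : ∀ i ≤ m, H.Adj z (f i) → i + 1 = m) : False := by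
  have fw : ∀ i, 1 ≤ i → i ≤ m → f i ≠ w := fun i hi him h => inj 0 i hi him (f0.trans h.symm)
  have hU : ∀ j, 2 ≤ j → j ≤ m → H.Adj (f 1) (f j) →
      ∃ u, H.Adj u (f 0) ∧ H.Adj u (f m) ∧ ¬ H.Adj u (f j) ∧ u ≠ w ∧ ∀ i ≤ m, f i ≠ u := by
    intro j hj hjm h1j
    have hw1 : H.Adj w (f 1) := by have := step 0 (by omega); rwa [f0] at this
    obtain ⟨u, h1, h2, h4⟩ := hmax (f j) (f 1) (fw j (by omega) hjm)
      (fun h => by have := hw j hjm h; omega) hw1 h1j.symm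
      (fun h => by have := hz 1 (by omega) h; omega)
    refine ⟨u, by rw [f0]; exact h1.symm, by rw [fm]; exact h2.symm, fun h => h4 h.symm,
      h1.ne.symm, ?_⟩
    rintro i him rfl
    have := hw i him h1
    have := hz i him h2
    omega
  by_cases hr : 1 ≤ a ∧ a + 2 ≤ b ∧ b + 1 ≤ m ∧ H.Adj (f a) (f b)
  · obtain ⟨ha, hab, hb, hadj⟩ := hr
    by_cases ha1 : a = 1
    · subst ha1
      obtain ⟨u, u0, um, huj, huw, hu⟩ := hU b (by omega) (by omega) hadj
      exact huj (hI.complete_chord u huw m f 1 b hodd inj hu step ch u0 um fw ha hab hb hadj b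
        (by omega) (by omega))
    · obtain ⟨u, u0, um, huj, huw, hu⟩ := hU 2 (by omega) (by omega) (step 1 (by omega))
      exact huj (hI.complete_chord u huw m f a b hodd inj hu step ch u0 um fw ha hab hb hadj 2
        (by omega) (by omega))
  · obtain ⟨u, u0, um, huj, huw, hu⟩ := hU 2 (by omega) (by omega) (step 1 (by omega))
    refine huj (hI.complete u huw m f hodd inj hu step ?_ u0 um fw 2 (by omega))
    intro i j hij hj hh
    rcases ch i j hij hj hh with h | ⟨rfl, rfl⟩
    · exact h
    · by_contra hne
      rcases Nat.eq_zero_or_pos i with h0 | h0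
      · subst h0
        rw [f0] at hh
        have := hw j hj hh
        omega
      · by_cases hjm : j = m
        · subst hjm
          rw [fm] at hh
          have := hz i (by omega) hh.symm
          omega
        · exact hr ⟨h0, by omega, by omega, hh⟩

/-- contraction of `z` into `w` (`z` becomes isolated) -/
def contr {V : Type*} (H : SimpleGraph V) (w z : V) : SimpleGraph V where
  Adj x y := x ≠ y ∧ x ≠ z ∧ y ≠ z ∧ (H.Adj x y ∨ (x = w ∧ H.Adj z y) ∨ (y = w ∧ H.Adj z x))
  symm := ⟨by
    rintro x y ⟨h1, h2, h3, h⟩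
    refine ⟨h1.symm, h3, h2, ?_⟩
    rcases h with h | h | h
    · exact Or.inl h.symm
    · exact Or.inr (Or.inr h)
    · exact Or.inr (Or.inl h)⟩
  loopless := ⟨fun x h => h.1 rfl⟩

theorem contr_other {V : Type*} {H : SimpleGraph V} {w z x y : V} (hx : x ≠ w) (hy : y ≠ w)
    (hxz : x ≠ z) (hyz : y ≠ z) : (contr H w z).Adj x y ↔ H.Adj x y := by
  constructor
  · rintro ⟨h1, h2, h3, h | h | h⟩
    · exact h
    · exact absurd h.1 hx
    · exact absurd h.1 hy
  · intro h
    exact ⟨h.ne, hxz, hyz, Or.inl h⟩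

theorem contr_w {V : Type*} {H : SimpleGraph V} {w z y : V} (hy : y ≠ w)
    (hyz : y ≠ z) (hwz : w ≠ z) : (contr H w z).Adj w y ↔ H.Adj w y ∨ H.Adj z y := by
  constructor
  · rintro ⟨h1, h2, h3, h | h | h⟩
    · exact Or.inl h
    · exact Or.inr h.2
    · exact absurd h.1 hy
  · rintro (h | h)
    · exact ⟨h.ne, hwz, hyz, Or.inl h⟩
    · exact ⟨hy.symm, hwz, hyz, Or.inr (Or.inl ⟨rfl, h⟩)⟩

end Mey

namespace Mey

/-- core in the form of a path `x 0, ..., x n` between `w` and `z` -/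
theorem Inv.core' {V : Type*} {H : SimpleGraph V} {w z : V} (hI : Inv H w) (hwz : w ≠ z)
    (hnwz : ¬ H.Adj w z)
    (hmax : ∀ t p, t ≠ w → ¬ H.Adj w t → H.Adj w p → H.Adj t p → ¬ H.Adj z p →
      ∃ u, H.Adj w u ∧ H.Adj z u ∧ ¬ H.Adj t u)
    (n : ℕ) (x : ℕ → V) (a b : ℕ) (hodd : Odd n)
    (xw : ∀ i ≤ n, x i ≠ w) (xz : ∀ i ≤ n, x i ≠ z)
    (inj : ∀ i j, i < j → j ≤ n → x i ≠ x j)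
    (step : ∀ i < n, H.Adj (x i) (x (i+1)))
    (ch : ∀ i j, i < j → j ≤ n → H.Adj (x i) (x j) → j = i + 1 ∨ (i = a ∧ j = b))
    (w0 : H.Adj w (x 0)) (zn : H.Adj z (x n))
    (hw : ∀ i ≤ n, H.Adj w (x i) → i = 0)
    (hz : ∀ i ≤ n, H.Adj z (x i) → i = n) : False := by
  obtain ⟨f, f0, fi, fm⟩ : ∃ f : ℕ → V, f 0 = w ∧ (∀ i ≤ n, f (i+1) = x i) ∧ f (n+2) = z := by
    refine ⟨fun i => if i = 0 then w else if i ≤ n + 1 then x (i-1) else z, by simp, ?_, by simp⟩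
    intro i hi
    simp [hi]
  have cases_ : ∀ i ≤ n + 2, i = 0 ∨ (∃ k ≤ n, i = k + 1) ∨ i = n + 2 := by
    intro i hi
    by_cases h0 : i = 0
    · exact Or.inl h0
    by_cases h1 : i = n + 2
    · exact Or.inr (Or.inr h1)
    exact Or.inr (Or.inl ⟨i - 1, by omega, by omega⟩)
  refine hI.core hmax (n+2) f (a+1) (b+1) (by grind) (by grind) f0 fm ?_ ?_ ?_ ?_ ?_
  · intro i j hij hj
    rcases cases_ i (by omega) with rfl | ⟨k, hk, rfl⟩ | rfl
    · rcases cases_ j hj with rfl | ⟨l, hl, rfl⟩ | rfl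
      · omega
      · rw [f0, fi l hl]; exact (xw l hl).symm
      · rw [f0, fm]; exact hwz
    · rcases cases_ j hj with rfl | ⟨l, hl, rfl⟩ | rfl
      · omega
      · rw [fi k hk, fi l hl]; exact inj _ _ (by omega) hl
      · rw [fi k hk, fm]; exact xz k hk
    · omega
  · intro i hi
    rcases cases_ i (by omega) with rfl | ⟨k, hk, rfl⟩ | rfl
    · rw [f0, fi 0 (by omega)]; exact w0
    · by_cases hkn : k = n
      · subst hkn
        rw [fi k hk, fm]; exact zn.symm
      · rw [fi k hk, fi (k+1) (by omega)]; exact step k (by omega)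
    · omega
  · intro i j hij hj hh
    rcases cases_ i (by omega) with rfl | ⟨k, hk, rfl⟩ | rfl
    · rcases cases_ j hj with rfl | ⟨l, hl, rfl⟩ | rfl
      · omega
      · rw [f0, fi l hl] at hh
        have := hw l hl hh; omega
      · rw [f0, fm] at hh; exact absurd hh hnwz
    · rcases cases_ j hj with rfl | ⟨l, hl, rfl⟩ | rfl
      · omega
      · rw [fi k hk, fi l hl] at hh
        have := ch _ _ (by omega) hl hh
        omega
      · rw [fi k hk, fm] at hh
        have := hz k hk hh.symm
        omega
    · omega
  · intro i hi hh
    rcases cases_ i (by omega) with rfl | ⟨k, hk, rfl⟩ | rfl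
    · rw [f0] at hh; exact absurd hh (H.irrefl)
    · rw [fi k hk] at hh
      have := hw k hk hh
      omega
    · rw [fm] at hh; exact absurd hh hnwz
  · intro i hi hh
    rcases cases_ i (by omega) with rfl | ⟨k, hk, rfl⟩ | rfl
    · rw [f0] at hh; exact absurd hh.symm hnwz
    · rw [fi k hk] at hh
      have := hz k hk hh
      omega
    · rw [fm] at hh; exact absurd hh (H.irrefl)

theorem Inv.contr {V : Type*} {H : SimpleGraph V} {w z : V} (hI : Inv H w) (hwz : w ≠ z)
    (hnwz : ¬ H.Adj w z)
    (hmax : ∀ t p, t ≠ w → ¬ H.Adj w t → H.Adj w p → H.Adj t p → ¬ H.Adj z p →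
      ∃ u, H.Adj w u ∧ H.Adj z u ∧ ¬ H.Adj t u) : Inv (contr H w z) w := by
  intro N c a b hB hcase
  have h5 := hB.five
  have cz : ∀ i < N, c i ≠ z := by
    intro i hi h
    by_cases h1 : i + 1 < N
    · have := hB.step i h1
      exact this.2.1 h
    · have := hB.close
      rw [show N - 1 = i by omega] at this
      exact this.2.1 h
  rcases hcase with hnw | ⟨hc0, ha⟩
  · refine hI N c a b ⟨hB.odd, h5, hB.inj, ?_, ?_, ?_⟩ (Or.inl hnw)
    · intro i hi
      exact (contr_other (hnw _ (by omega)) (hnw _ hi) (cz _ (by omega)) (cz _ hi)).1 (hB.step i hi)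
    · exact (contr_other (hnw _ (by omega)) (hnw _ (by omega)) (cz _ (by omega))
        (cz _ (by omega))).1 hB.close
    · intro i j hij hj hh
      exact hB.chord i j hij hj ((contr_other (hnw _ (by omega)) (hnw _ hj) (cz _ (by omega))
        (cz _ hj)).2 hh)
  · have cw : ∀ i, 1 ≤ i → i < N → c i ≠ w := fun i hi hiN h =>
      hB.inj 0 i hi hiN (hc0.trans h.symm)
    have oth : ∀ i j, 1 ≤ i → i < N → 1 ≤ j → j < N →
        ((Mey.contr H w z).Adj (c i) (c j) ↔ H.Adj (c i) (c j)) := fun i j hi hiN hj hjN =>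
      contr_other (cw i hi hiN) (cw j hj hjN) (cz i hiN) (cz j hjN)
    have wad : ∀ i, 1 ≤ i → i < N → (H.Adj w (c i) ∨ H.Adj z (c i)) → i = 1 ∨ i = N - 1 := by
      intro i hi hiN hh
      have := (contr_w (cw i hi hiN) (cz i hiN) hwz).2 hh
      have := hB.chord 0 i hi hiN (by rw [hc0]; exact this)
      omega
    have hp : H.Adj w (c 1) ∨ H.Adj z (c 1) := by
      have := hB.step 0 (by omega)
      rw [hc0] at this
      exact (contr_w (cw 1 le_rfl (by omega)) (cz 1 (by omega)) hwz).1 this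
    have hq : H.Adj w (c (N-1)) ∨ H.Adj z (c (N-1)) := by
      have := hB.close.symm
      rw [hc0] at this
      exact (contr_w (cw _ (by omega) (by omega)) (cz _ (by omega)) hwz).1 this
    by_cases hww : H.Adj w (c 1) ∧ H.Adj w (c (N-1))
    · refine hI N c a b ⟨hB.odd, h5, hB.inj, ?_, ?_, ?_⟩ (Or.inr ⟨hc0, ha⟩)
      · intro i hi
        rcases Nat.eq_zero_or_pos i with rfl | h0
        · rw [hc0]; exact hww.1
        · exact (oth i (i+1) h0 (by omega) (by omega) hi).1 (hB.step i hi)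
      · rw [hc0]; exact hww.2.symm
      · intro i j hij hj hh
        rcases Nat.eq_zero_or_pos i with rfl | h0
        · rw [hc0] at hh
          have := wad j hij hj (Or.inl hh)
          omega
        · exact hB.chord i j hij hj ((oth i j h0 (by omega) (by omega) hj).2 hh)
    by_cases hzz : H.Adj z (c 1) ∧ H.Adj z (c (N-1))
    · obtain ⟨g, g0, gi⟩ : ∃ g : ℕ → V, g 0 = z ∧ ∀ i, 1 ≤ i → g i = c i :=
        ⟨fun i => if i = 0 then z else c i, by simp, fun i hi => by
          simp [show i ≠ 0 by omega]⟩
      refine hI N g a b ⟨hB.odd, h5, ?_, ?_, ?_, ?_⟩ (Or.inl ?_)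
      · intro i j hij hj
        rcases Nat.eq_zero_or_pos i with rfl | h0
        · rw [g0, gi j hij]; exact (cz j hj).symm
        · rw [gi i h0, gi j (by omega)]; exact hB.inj i j hij hj
      · intro i hi
        rcases Nat.eq_zero_or_pos i with rfl | h0
        · rw [g0, gi _ (by omega)]; exact hzz.1
        · rw [gi i h0, gi _ (by omega)]
          exact (oth i (i+1) h0 (by omega) (by omega) hi).1 (hB.step i hi)
      · rw [g0, gi _ (by omega)]; exact hzz.2.symm
      · intro i j hij hj hh
        rcases Nat.eq_zero_or_pos i with rfl | h0
        · rw [g0, gi _ (by omega)] at hh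
          have := wad j hij hj (Or.inr hh)
          omega
        · rw [gi i h0, gi _ (by omega)] at hh
          exact hB.chord i j hij hj ((oth i j h0 (by omega) (by omega) hj).2 hh)
      · intro i hi
        rcases Nat.eq_zero_or_pos i with rfl | h0
        · rw [g0]; exact hwz.symm
        · rw [gi i h0]; exact cw i h0 hi
    have hNodd := hB.odd
    by_cases hp1 : H.Adj w (c 1)
    · have hq1 : ¬ H.Adj w (c (N-1)) := fun h => hww ⟨hp1, h⟩
      have hq2 : H.Adj z (c (N-1)) := hq.resolve_left hq1
      have hp2 : ¬ H.Adj z (c 1) := fun h => hzz ⟨h, hq2⟩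
      refine hI.core' hwz hnwz hmax (N-2) (fun i => c (i+1)) (a-1) (b-1) (by grind)
        (fun i hi => cw _ (by omega) (by omega)) (fun i hi => cz _ (by omega))
        (fun i j hij hj => hB.inj _ _ (by omega) (by omega))
        (fun i hi => (oth _ _ (by omega) (by omega) (by omega) (by omega)).1
          (hB.step _ (by omega)))
        ?_ hp1 (by simpa [show N - 2 + 1 = N - 1 by omega] using hq2) ?_ ?_
      · intro i j hij hj hh
        have := hB.chord _ _ (by omega) (by omega)
          ((oth (i+1) (j+1) (by omega) (by omega) (by omega) (by omega)).2 hh)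
        omega
      · intro i hi hh
        rcases wad (i+1) (by omega) (by omega) (Or.inl hh) with h | h
        · omega
        · exfalso; simp only [h] at hh; exact hq1 hh
      · intro i hi hh
        rcases wad (i+1) (by omega) (by omega) (Or.inr hh) with h | h
        · exfalso; simp only [h] at hh; exact hp2 hh
        · omega
    · have hp2 : H.Adj z (c 1) := hp.resolve_left hp1
      have hq2 : ¬ H.Adj z (c (N-1)) := fun h => hzz ⟨hp2, h⟩
      have hq1 : H.Adj w (c (N-1)) := hq.resolve_right hq2
      refine hI.core' hwz hnwz hmax (N-2) (fun i => c (N-1-i)) (N-1-b) (N-1-a) (by grind)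
        (fun i hi => cw _ (by omega) (by omega)) (fun i hi => cz _ (by omega))
        (fun i j hij hj => (hB.inj _ _ (by omega) (by omega)).symm)
        (fun i hi => ?_)
        ?_ hq1 (by simpa [show N - 1 - (N - 2) = 1 by omega] using hp2) ?_ ?_
      · have := hB.step (N-1-(i+1)) (by omega)
        rw [oth _ _ (by omega) (by omega) (by omega) (by omega),
          show N-1-(i+1)+1 = N-1-i by omega] at this
        exact this.symm
      · intro i j hij hj hh
        have := hB.chord (N-1-j) (N-1-i) (by omega) (by omega)
          ((oth _ _ (by omega) (by omega) (by omega) (by omega)).2 hh.symm)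
        omega
      · intro i hi hh
        rcases wad (N-1-i) (by omega) (by omega) (Or.inl hh) with h | h
        · exfalso; simp only [h] at hh; exact hp1 hh
        · omega
      · intro i hi hh
        rcases wad (N-1-i) (by omega) (by omega) (Or.inr hh) with h | h
        · omega
        · exfalso; simp only [h] at hh; exact hq2 hh

theorem exists_stable {V : Type*} [Fintype V] (w : V) (n : ℕ) :
    ∀ (H : SimpleGraph V) (A : Finset V), A.card = n → w ∈ A → Inv H w →
      (∀ x y, H.Adj x y → x ∈ A) →
      ∃ S : Set V, w ∈ S ∧ (∀ x ∈ S, ∀ y ∈ S, ¬ H.Adj x y) ∧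
        ∀ Q : Set V, Q ⊆ A → (∀ x ∈ Q, x ∉ S) → (∀ x ∈ Q, ∀ y ∈ Q, x ≠ y → H.Adj x y) →
          ∃ s ∈ S, ∀ x ∈ Q, H.Adj s x := by
  classical
  induction n with
  | zero =>
    intro H A hA hw
    rw [Finset.card_eq_zero] at hA
    simp [hA] at hw
  | succ n ih =>
    intro H A hA hwA hI hadj
    by_cases huniv : ∀ x ∈ A, x ≠ w → H.Adj w x
    · refine ⟨{w}, rfl, ?_, ?_⟩
      · rintro x rfl y rfl; exact H.irrefl
      · intro Q hQA hQ _
        exact ⟨w, rfl, fun x hx => huniv x (hQA hx) (hQ x hx)⟩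
    push Not at huniv
    obtain ⟨x0, hx0A, hx0w, hx0⟩ := huniv
    obtain ⟨z, hz, hzmax⟩ := Finset.exists_max_image
      (A.filter (fun x => x ≠ w ∧ ¬ H.Adj w x))
      (fun x => (Finset.univ.filter (fun u => H.Adj w u ∧ H.Adj x u)).card)
      ⟨x0, by simp [hx0A, hx0w, hx0]⟩
    simp only [Finset.mem_filter] at hz hzmax
    obtain ⟨hzA, hzw, hnwz⟩ := hz
    have hmax : ∀ t p, t ≠ w → ¬ H.Adj w t → H.Adj w p → H.Adj t p → ¬ H.Adj z p →
        ∃ u, H.Adj w u ∧ H.Adj z u ∧ ¬ H.Adj t u := by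
      intro t p htw hwt hwp htp hzp
      by_contra hcon
      push Not at hcon
      have h1 := hzmax t ⟨hadj _ _ htp, htw, hwt⟩
      have h2 : (Finset.univ.filter (fun u => H.Adj w u ∧ H.Adj z u)) ⊂
          (Finset.univ.filter (fun u => H.Adj w u ∧ H.Adj t u)) := by
        rw [Finset.ssubset_iff_of_subset]
        · exact ⟨p, by simp [hwp, htp], by simp [hzp]⟩
        · intro u hu
          simp only [Finset.mem_filter, Finset.mem_univ, true_and] at hu ⊢
          exact ⟨hu.1, hcon u hu.1 hu.2⟩
      have := Finset.card_lt_card h2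
      omega
    have hwz : w ≠ z := hzw.symm
    obtain ⟨S, hwS, hst, hcl⟩ := ih (contr H w z) (A.erase z)
      (by rw [Finset.card_erase_of_mem hzA]; omega) (by simp [hwA, hwz])
      (hI.contr hwz hnwz hmax) (by
        rintro x y ⟨h1, h2, h3, h | h | h⟩
        · simp [h2, hadj _ _ h]
        · simp [hwz, h.1, hwA]
        · simp [h2, hadj _ _ h.2.symm])
    have stw : ∀ y ∈ S, y ≠ z → ¬ H.Adj w y ∧ ¬ H.Adj z y := by
      intro y hy hyz
      by_cases hyw : y = w
      · subst hyw
        exact ⟨H.irrefl, fun h => hnwz h.symm⟩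
      · have := hst w hwS y hy
        rw [contr_w hyw hyz hwz] at this
        tauto
    have stz : ∀ y ∈ S, ¬ H.Adj z y := by
      intro y hy
      by_cases hyz : y = z
      · rw [hyz]; exact H.irrefl
      · exact (stw y hy hyz).2
    refine ⟨insert z S, Set.mem_insert_of_mem _ hwS, ?_, ?_⟩
    · intro x hx y hy hh
      rw [Set.mem_insert_iff] at hx hy
      rcases hx with rfl | hx
      · rcases hy with rfl | hy
        · exact H.irrefl hh
        · exact stz y hy hh
      · rcases hy with rfl | hy
        · exact stz x hx hh.symm
        · by_cases hxz : x = z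
          · subst hxz; exact stz y hy hh
          by_cases hyz : y = z
          · subst hyz; exact stz x hx hh.symm
          exact hst x hx y hy ⟨hh.ne, hxz, hyz, Or.inl hh⟩
    · intro Q hQA hQS hQ
      have hQz : ∀ x ∈ Q, x ≠ z := fun x hx h => hQS x hx (by simp [h])
      have hQw : ∀ x ∈ Q, x ≠ w := fun x hx h => hQS x hx (by simp [h, hwS])
      obtain ⟨s, hs, hsQ⟩ := hcl Q
        (fun x hx => by simpa [hQz x hx] using hQA hx)
        (fun x hx h => hQS x hx (Set.mem_insert_of_mem _ h))
        (fun x hx y hy hxy => ⟨hxy, hQz x hx, hQz y hy, Or.inl (hQ x hx y hy hxy)⟩)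
      by_cases hsw : s = w
      · subst hsw
        by_cases h1 : ∀ x ∈ Q, H.Adj s x
        · exact ⟨s, Set.mem_insert_of_mem _ hs, h1⟩
        by_cases h2 : ∀ x ∈ Q, H.Adj z x
        · exact ⟨z, Set.mem_insert _ _, h2⟩
        exfalso
        push Not at h1 h2
        obtain ⟨q, hq, hsq⟩ := h1
        obtain ⟨p, hp, hzp⟩ := h2
        have hwp := ((contr_w (hQw p hp) (hQz p hp) hwz).1 (hsQ p hp)).resolve_right hzp
        have hzq := ((contr_w (hQw q hq) (hQz q hq) hwz).1 (hsQ q hq)).resolve_left hsq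
        have hpq : p ≠ q := fun h => hsq (h ▸ hwp)
        refine hI.core' hwz hnwz hmax 1 (fun i => if i = 0 then p else q) 0 1 (by simp)
          ?_ ?_ ?_ ?_ ?_ (by simpa using hwp) (by simpa using hzq) ?_ ?_
        · intro i _; by_cases h : i = 0
          · simpa [h] using hQw p hp
          · simpa [h] using hQw q hq
        · intro i _; by_cases h : i = 0
          · simpa [h] using hQz p hp
          · simpa [h] using hQz q hq
        · intro i j hij hj
          obtain rfl : i = 0 := by omega
          obtain rfl : j = 1 := by omega
          simpa using hpq
        · intro i hi
          obtain rfl : i = 0 := by omega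
          simpa using hQ p hp q hq hpq
        · intro i j hij hj _
          omega
        · intro i hi hh
          by_contra h
          simp [h] at hh; exact hsq hh
        · intro i hi hh
          by_contra h
          obtain rfl : i = 0 := by omega
          simp at hh; exact hzp hh
      · refine ⟨s, Set.mem_insert_of_mem _ hs, fun x hx => ?_⟩
        have := hsQ x hx
        exact (contr_other hsw (hQw x hx) this.2.1 (hQz x hx)).1 this

theorem color {V : Type*} [Fintype V] (G : SimpleGraph V) (hG : ¬ G.HasMeynielObstruction)
    (k : ℕ) : ∀ A : Finset V, (∀ Q : Finset V, Q ⊆ A → G.IsClique Q → Q.card ≤ k) →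
      ∃ f : V → ℕ, (∀ x ∈ A, f x < k) ∧ ∀ x ∈ A, ∀ y ∈ A, G.Adj x y → f x ≠ f y := by
  classical
  induction k with
  | zero =>
    intro A hA
    have : ∀ x, x ∉ A := by
      intro x hx
      have := hA {x} (by simpa using hx) (by simp)
      simp at this
    exact ⟨fun _ => 0, fun x hx => absurd hx (this x), fun x hx => absurd hx (this x)⟩
  | succ k ih =>
    intro A hA
    rcases A.eq_empty_or_nonempty with rfl | ⟨w, hw⟩
    · exact ⟨fun _ => 0, by simp, by simp⟩
    let H : SimpleGraph V :=
      { Adj := fun x y => x ∈ A ∧ y ∈ A ∧ G.Adj x y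
        symm := ⟨fun x y h => ⟨h.2.1, h.1, h.2.2.symm⟩⟩
        loopless := ⟨fun x h => G.irrefl h.2.2⟩ }
    have hI : Inv H w := by
      intro N c a b hB _
      have h5 := hB.five
      have cA : ∀ i < N, c i ∈ A := by
        intro i hi
        by_cases h1 : i + 1 < N
        · exact (hB.step i h1).1
        · have := hB.close
          rw [show N - 1 = i by omega] at this
          exact this.1
      refine hG (BadSeq.obstruction (c := c) (N := N) (a := a) (b := b)
        ⟨hB.odd, h5, hB.inj, fun i hi => (hB.step i hi).2.2, hB.close.2.2, ?_⟩)
      intro i j hij hj hh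
      exact hB.chord i j hij hj ⟨cA i (by omega), cA j hj, hh⟩
    obtain ⟨S, hwS, hst, hcl⟩ := exists_stable w _ H A rfl hw hI (fun x y h => h.1)
    obtain ⟨f, hf1, hf2⟩ := ih (A.filter (fun x => x ∉ S)) (by
      intro Q hQA hQ
      rcases Q.eq_empty_or_nonempty with rfl | ⟨q, hq⟩
      · simp
      have hQA' : ∀ x ∈ Q, x ∈ A ∧ x ∉ S := fun x hx => by simpa using hQA hx
      obtain ⟨s, hs, hsQ⟩ := hcl Q (fun x hx => (hQA' x hx).1) (fun x hx => (hQA' x hx).2)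
        (fun x hx y hy hxy => ⟨(hQA' x hx).1, (hQA' y hy).1, hQ hx hy hxy⟩)
      have hsnQ : s ∉ Q := fun h => (hQA' s h).2 hs
      have := hA (insert s Q) (by
        intro x hx
        rw [Finset.mem_insert] at hx
        rcases hx with rfl | hx
        · exact (hsQ q hq).1
        · exact (hQA' x hx).1) (by
        rw [Finset.coe_insert, SimpleGraph.isClique_insert]
        exact ⟨hQ, fun b hb _ => (hsQ b hb).2.2⟩)
      rw [Finset.card_insert_of_notMem hsnQ] at this
      omega)
    refine ⟨fun x => if x ∈ S then k else f x, ?_, ?_⟩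
    · intro x hx
      by_cases h : x ∈ S
      · simp [h]
      · have := hf1 x (by simp [hx, h])
        simp only [h, if_false]; omega
    · intro x hx y hy hxy
      by_cases h : x ∈ S <;> by_cases h' : y ∈ S
      · exact absurd ⟨hx, hy, hxy⟩ (hst x h y h')
      · have := hf1 y (by simp [hy, h'])
        simp only [h, h', if_true, if_false]; omega
      · have := hf1 x (by simp [hx, h])
        simp only [h, h', if_true, if_false]; omega
      · simp only [h, h', if_false]
        exact hf2 x (by simp [hx, h]) y (by simp [hy, h']) hxy

end Mey

/-- For any graph `G`, either `G` contains a Meyniel obstruction, or the chromatic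
number of `G` equals its clique number (or both). -/
theorem hasMeynielObstruction_or_chromaticNumber_eq_cliqueNum {V : Type*} [Fintype V]
    (G : SimpleGraph V) :
    G.HasMeynielObstruction ∨ G.chromaticNumber = G.cliqueNum := by
  by_cases hG : G.HasMeynielObstruction
  · exact Or.inl hG
  right
  obtain ⟨f, hf1, hf2⟩ := Mey.color G hG G.cliqueNum Finset.univ
    (fun Q _ hQ => hQ.card_le_cliqueNum)
  refine le_antisymm (Colorable.chromaticNumber_le ⟨Coloring.mk
    (fun x => (⟨f x, hf1 x (Finset.mem_univ x)⟩ : Fin G.cliqueNum)) ?_⟩)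
    G.cliqueNum_le_chromaticNumber
  intro x y hxy h
  exact hf2 x (Finset.mem_univ x) y (Finset.mem_univ y) hxy (Fin.mk.inj_iff.1 h)
end
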